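/- For 0 ≤ p ≤ 1/4, the quantum capacity of the depolarizing channel satisfies Q(N_p) ≤ co[Δ, L](p), where Δ(p) is the minimum of H(½(1+sin u · sin v)) − H(½(1+cos u · cos v)) over all real pairs (u,v) satisfying cos²(u/2)·cos²(v/2) = 1−p and |sin v| ≤ |cos u|, L(p) = 1−4p, and co[Δ, L] denotes the largest convex function on [0,1/4] that is pointwise less than or equal to both Δ and L. -/

import Mathlib

open scoped Matrix Kronecker ComplexOrder

/-- A finite family of Kraus operators from input space `A` to output space `B`. -/
structure KrausFamily (A B : Type) [Fintype A] [DecidableEq A] [Fintype B] [DecidableEq B] :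
    Type 1 where
  ι : Type
  [fι : Fintype ι]
  [dι : DecidableEq ι]
  K : ι → Matrix B A ℂ

attribute [instance] KrausFamily.fι KrausFamily.dι

variable {A B : Type} [Fintype A] [DecidableEq A] [Fintype B] [DecidableEq B]

/-- The trace-preservation condition `Σ Kᵢ† Kᵢ = 1` making a Kraus family a quantum channel. -/
def KrausFamily.IsChannel (N : KrausFamily A B) : Prop :=
  ∑ i, (N.K i)ᴴ * N.K i = 1

/-- The action of a channel: `N(ρ) = Σ Kᵢ ρ Kᵢ†`. -/
noncomputable def KrausFamily.apply (N : KrausFamily A B) (ρ : Matrix A A ℂ) : Matrix B B ℂ :=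
  ∑ i, N.K i * ρ * (N.K i)ᴴ

/-- The complementary channel: `N̂(ρ)ᵢⱼ = Tr (Kᵢ ρ Kⱼ†)`. -/
noncomputable def KrausFamily.compl (N : KrausFamily A B) (ρ : Matrix A A ℂ) :
    Matrix N.ι N.ι ℂ :=
  Matrix.of fun i j => (N.K i * ρ * (N.K j)ᴴ).trace

/-- Von Neumann entropy, base 2: `S(ρ) = −Σ λⱼ log₂ λⱼ` over the eigenvalues of `ρ`
(junk value `0` for non-Hermitian matrices). -/
noncomputable def vnEntropy {n : Type} [Fintype n] [DecidableEq n] (ρ : Matrix n n ℂ) : ℝ :=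
  if h : ρ.IsHermitian then -∑ j, h.eigenvalues j * Real.logb 2 (h.eigenvalues j) else 0

/-- A density matrix: positive semidefinite with unit trace. -/
def IsDensity {n : Type} [Fintype n] (ρ : Matrix n n ℂ) : Prop :=
  ρ.PosSemidef ∧ ρ.trace = 1

/-- Coherent information of `N` at input `φ`: `I^c(N,φ) = S(N(φ)) − S(N̂(φ))`. -/
noncomputable def cohInfo (N : KrausFamily A B) (φ : Matrix A A ℂ) : ℝ :=
  vnEntropy (N.apply φ) - vnEntropy (N.compl φ)

/-- One-shot quantum capacity: `Q^{(1)}(N) = sup_φ I^c(N,φ)` over density matrices `φ`. -/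
noncomputable def Q1 (N : KrausFamily A B) : ℝ :=
  sSup {x | ∃ φ : Matrix A A ℂ, IsDensity φ ∧ x = cohInfo N φ}

/-- The `n`-th tensor power of a Kraus family, whose Kraus operators are all `n`-fold
Kronecker products of Kraus operators of `N`. -/
noncomputable def KrausFamily.pow (N : KrausFamily A B) (n : ℕ) :
    KrausFamily (Fin n → A) (Fin n → B) where
  ι := Fin n → N.ι
  K f := Matrix.of fun b a => ∏ i, N.K (f i) (b i) (a i)

/-- Quantum capacity: `Q(N) = sup_{n ≥ 1} (1/n) Q^{(1)}(N^{⊗n})`. -/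
noncomputable def Qcap (N : KrausFamily A B) : ℝ :=
  sSup {x | ∃ n : ℕ, 0 < n ∧ x = (1 / (n : ℝ)) * Q1 (N.pow n)}

/-- `N` is degradable if some channel `D` maps its output to its complementary output. -/
def KrausFamily.IsDegradable (N : KrausFamily A B) : Prop :=
  ∃ D : KrausFamily B N.ι, D.IsChannel ∧ ∀ ρ : Matrix A A ℂ, D.apply (N.apply ρ) = N.compl ρ

/-- `N` is antidegradable if some channel `D` maps its complementary output to its output. -/
def KrausFamily.IsAntidegradable (N : KrausFamily A B) : Prop :=
  ∃ D : KrausFamily N.ι B, D.IsChannel ∧ ∀ ρ : Matrix A A ℂ, D.apply (N.compl ρ) = N.apply ρ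

/-- Pauli `X`. -/
def PauliX : Matrix (Fin 2) (Fin 2) ℂ := !![0, 1; 1, 0]

/-- Pauli `Y`. -/
def PauliY : Matrix (Fin 2) (Fin 2) ℂ := !![0, -Complex.I; Complex.I, 0]

/-- Pauli `Z`. -/
def PauliZ : Matrix (Fin 2) (Fin 2) ℂ := !![1, 0; 0, -1]

/-- The depolarizing channel with error probability `p`:
`N_p(ρ) = (1−p)ρ + (p/3)XρX + (p/3)YρY + (p/3)ZρZ`. -/
noncomputable def depol (p : ℝ) : KrausFamily (Fin 2) (Fin 2) where
  ι := Fin 4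
  K := ![((Real.sqrt (1 - p) : ℝ) : ℂ) • 1,
        ((Real.sqrt (p / 3) : ℝ) : ℂ) • PauliX,
        ((Real.sqrt (p / 3) : ℝ) : ℂ) • PauliY,
        ((Real.sqrt (p / 3) : ℝ) : ℂ) • PauliZ]

/-- Binary entropy `H(x) = −x log₂ x − (1−x) log₂ (1−x)`. -/
noncomputable def binEnt (x : ℝ) : ℝ :=
  -x * Real.logb 2 x - (1 - x) * Real.logb 2 (1 - x)

/-- The pointwise value at `x` of the largest function that is convex on `[0, 1/4]` and is
a pointwise lower bound on `[0, 1/4]` for every member of the family `F`. -/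
noncomputable def convEnv (F : Set (ℝ → ℝ)) (x : ℝ) : ℝ :=
  sSup {y | ∃ g : ℝ → ℝ, ConvexOn ℝ (Set.Icc (0 : ℝ) (1 / 4)) g ∧
    (∀ z ∈ Set.Icc (0 : ℝ) (1 / 4), ∀ f ∈ F, g z ≤ f z) ∧ y = g x}

/-- `Δ(p)`: the minimum of `H(½(1+sin u sin v)) − H(½(1+cos u cos v))` over all real
pairs `(u,v)` with `cos²(u/2) cos²(v/2) = 1 − p` and `|sin v| ≤ |cos u|`. -/
noncomputable def Δdep (p : ℝ) : ℝ :=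
  sInf {y | ∃ u v : ℝ, Real.cos (u / 2) ^ 2 * Real.cos (v / 2) ^ 2 = 1 - p ∧
    |Real.sin v| ≤ |Real.cos u| ∧
    y = binEnt ((1 + Real.sin u * Real.sin v) / 2) -
        binEnt ((1 + Real.cos u * Real.cos v) / 2)}

theorem vnEntropy_eq_roots {n : Type} [Fintype n] [DecidableEq n] {ρ : Matrix n n ℂ}
    (h : ρ.IsHermitian) :
    vnEntropy ρ = (ρ.charpoly.roots.map fun z => -(z.re * Real.logb 2 z.re)).sum := by
  rw [vnEntropy, dif_pos h, h.roots_charpoly_eq_eigenvalues, Multiset.map_map]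
  simp [Finset.sum_neg_distrib]

/-- The entropy can be read off any unitary diagonalization. -/
theorem vnEntropy_eq_sum_of_diagonalization {n : Type} [Fintype n] [DecidableEq n]
    {ρ U : Matrix n n ℂ} {p : n → ℝ} (hU : Uᴴ * U = 1)
    (h : ρ = U * Matrix.diagonal (fun i => (p i : ℂ)) * Uᴴ) :
    vnEntropy ρ = -∑ i, p i * Real.logb 2 (p i) := by
  have hρ : ρ.IsHermitian := by
    rw [h]
    refine Matrix.isHermitian_mul_mul_conjTranspose _ ?_
    rw [Matrix.isHermitian_diagonal_iff]
    intro i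
    exact Complex.conj_ofReal _
  have hc : ρ.charpoly.roots = Multiset.map (fun i => (p i : ℂ)) Finset.univ.val := by
    rw [h, Matrix.charpoly_mul_comm, ← mul_assoc, hU, one_mul, Matrix.charpoly_diagonal,
      Polynomial.roots_prod]
    · simp
    · simp [Finset.prod_ne_zero_iff, Polynomial.X_sub_C_ne_zero]
  rw [vnEntropy_eq_roots hρ, hc, Multiset.map_map]
  simp [Finset.sum_neg_distrib]

theorem vnEntropy_diagonal {n : Type} [Fintype n] [DecidableEq n] (p : n → ℝ) :
    vnEntropy (Matrix.diagonal fun i => (p i : ℂ)) = -∑ i, p i * Real.logb 2 (p i) :=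
  vnEntropy_eq_sum_of_diagonalization (U := 1) (by simp) (by simp)

theorem Matrix.IsHermitian.exists_diagonalization {n : Type} [Fintype n] [DecidableEq n]
    {ρ : Matrix n n ℂ} (h : ρ.IsHermitian) :
    ∃ U : Matrix n n ℂ, U * Uᴴ = 1 ∧ Uᴴ * U = 1 ∧
      ρ = U * Matrix.diagonal (fun i => (h.eigenvalues i : ℂ)) * Uᴴ := by
  refine ⟨h.eigenvectorUnitary, ?_, ?_, ?_⟩
  · exact Unitary.mul_star_self_of_mem h.eigenvectorUnitary.2
  · exact Unitary.star_mul_self_of_mem h.eigenvectorUnitary.2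
  · conv_lhs => rw [h.spectral_theorem, Unitary.conjStarAlgAut_apply]
    rfl

theorem Matrix.PosSemidef.exists_diagonalization {n : Type} [Fintype n] [DecidableEq n]
    {ρ : Matrix n n ℂ} (h : ρ.PosSemidef) :
    ∃ (U : Matrix n n ℂ) (p : n → ℝ), U * Uᴴ = 1 ∧ Uᴴ * U = 1 ∧ (∀ i, 0 ≤ p i) ∧
      ρ = U * Matrix.diagonal (fun i => (p i : ℂ)) * Uᴴ := by
  obtain ⟨U, h1, h2, h3⟩ := h.isHermitian.exists_diagonalization
  exact ⟨U, _, h1, h2, h.eigenvalues_nonneg, h3⟩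

theorem vnEntropy_transpose {n : Type} [Fintype n] [DecidableEq n] {ρ : Matrix n n ℂ}
    (h : ρ.IsHermitian) : vnEntropy ρᵀ = vnEntropy ρ := by
  rw [vnEntropy_eq_roots h, vnEntropy_eq_roots h.transpose, Matrix.charpoly_transpose]

theorem vnEntropy_submatrix_equiv {n m : Type} [Fintype n] [DecidableEq n] [Fintype m]
    [DecidableEq m] {ρ : Matrix n n ℂ} (h : ρ.IsHermitian) (e : m ≃ n) :
    vnEntropy (ρ.submatrix e e) = vnEntropy ρ := by
  rw [vnEntropy_eq_roots h, vnEntropy_eq_roots (h.submatrix e)]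
  rw [← Matrix.charpoly_reindex e.symm ρ]
  rfl

theorem vnEntropy_mul_conjTranspose {n m : Type} [Fintype n] [DecidableEq n] [Fintype m]
    [DecidableEq m] (X : Matrix n m ℂ) : vnEntropy (X * Xᴴ) = vnEntropy (Xᴴ * X) := by
  rw [vnEntropy_eq_roots (Matrix.isHermitian_mul_conjTranspose_self X),
    vnEntropy_eq_roots (Matrix.isHermitian_conjTranspose_mul_self X)]
  have h := congrArg
    (fun P : Polynomial ℂ => (P.roots.map fun z => -(z.re * Real.logb 2 z.re)).sum)
    (Matrix.charpoly_mul_comm' X Xᴴ)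
  have hX : ∀ (k : ℕ) (Q : Polynomial ℂ), Q.Monic →
      ((Polynomial.X ^ k * Q).roots.map fun z : ℂ => -(z.re * Real.logb 2 z.re)).sum =
        (Q.roots.map fun z : ℂ => -(z.re * Real.logb 2 z.re)).sum := by
    intro k Q hQ
    rw [Polynomial.roots_mul ((Polynomial.monic_X_pow k).mul hQ).ne_zero]
    simp [Multiset.nsmul_singleton]
  simpa only [hX _ _ (Matrix.charpoly_monic _)] using h

theorem vnEntropy_fromBlocks {n m : Type} [Fintype n] [DecidableEq n] [Fintype m]
    [DecidableEq m] {ρ : Matrix n n ℂ} {σ : Matrix m m ℂ} (hρ : ρ.IsHermitian)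
    (hσ : σ.IsHermitian) :
    vnEntropy (Matrix.fromBlocks ρ 0 0 σ) = vnEntropy ρ + vnEntropy σ := by
  have h : (Matrix.fromBlocks ρ 0 0 σ).IsHermitian := by
    rw [Matrix.isHermitian_fromBlocks_iff]
    exact ⟨hρ, by simp, by simp, hσ⟩
  rw [vnEntropy_eq_roots h, vnEntropy_eq_roots hρ, vnEntropy_eq_roots hσ,
    Matrix.charpoly_fromBlocks_zero₁₂,
    Polynomial.roots_mul ((Matrix.charpoly_monic _).mul (Matrix.charpoly_monic _)).ne_zero]
  simp

theorem vnEntropy_smul {n : Type} [Fintype n] [DecidableEq n] {ρ : Matrix n n ℂ}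
    (h : ρ.IsHermitian) {c : ℝ} (hc : 0 ≤ c) :
    vnEntropy ((c : ℂ) • ρ) = c * vnEntropy ρ - c * Real.logb 2 c * ρ.trace.re := by
  obtain ⟨U, hU, hU', hd⟩ := h.exists_diagonalization
  have hd' : (c : ℂ) • ρ =
      U * Matrix.diagonal (fun i => ((c * h.eigenvalues i : ℝ) : ℂ)) * Uᴴ := by
    conv_lhs => rw [hd]
    rw [← Matrix.smul_mul, ← Matrix.mul_smul]
    congr 2
    ext i j
    by_cases hij : i = j <;> simp [Matrix.diagonal, hij]
  rw [vnEntropy_eq_sum_of_diagonalization hU' hd', vnEntropy_eq_sum_of_diagonalization hU' hd,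
    h.trace_eq_sum_eigenvalues]
  rw [mul_neg, Finset.mul_sum]
  rw [Complex.re_sum, Finset.mul_sum]
  rw [← Finset.sum_neg_distrib, ← Finset.sum_neg_distrib, ← Finset.sum_sub_distrib]
  refine Finset.sum_congr rfl fun i _ => ?_
  rcases hc.eq_or_lt with rfl | hc
  · simp
  rcases eq_or_ne (h.eigenvalues i) 0 with h0 | h0
  · simp [h0]
  rw [Real.logb_mul hc.ne' h0]
  simp
  ring

/-- If `∑ cₖ / (xₖ + t) ≥ 0` for all `t > 0` and `∑ cₖ = 0`, then `∑ cₖ log xₖ ≤ 0`. -/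
theorem sum_mul_log_nonpos {κ : Type*} [Fintype κ] (c x : κ → ℝ) (hx : ∀ k, 0 < x k)
    (hc : ∑ k, c k = 0) (h : ∀ t : ℝ, 0 < t → 0 ≤ ∑ k, c k / (x k + t)) :
    ∑ k, c k * Real.log (x k) ≤ 0 := by
  set G : ℝ → ℝ := fun t => ∑ k, c k * Real.log (x k + t) with hG
  have hder : ∀ t : ℝ, 0 ≤ t → HasDerivAt G (∑ k, c k / (x k + t)) t := by
    intro t ht
    refine HasDerivAt.fun_sum fun k _ => ?_
    have h1 : HasDerivAt (fun t => x k + t) 1 t := (hasDerivAt_id t).const_add (x k)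
    have h2 := (h1.log (by have := hx k; positivity)).const_mul (c k)
    simpa [div_eq_mul_inv] using h2
  have hmono : MonotoneOn G (Set.Ici 0) := by
    refine monotoneOn_of_deriv_nonneg (convex_Ici 0)
      (fun t ht => (hder t ht).continuousAt.continuousWithinAt) ?_ ?_
    · intro t ht
      rw [interior_Ici] at ht
      exact (hder t (le_of_lt ht)).differentiableAt.differentiableWithinAt
    · intro t ht
      rw [interior_Ici] at ht
      rw [(hder t (le_of_lt ht)).deriv]
      exact h t ht
  have hlim : Filter.Tendsto G Filter.atTop (nhds 0) := by
    have h1 : Filter.Tendsto (fun t : ℝ => ∑ k, c k * Real.log (x k / t + 1)) Filter.atTop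
        (nhds (∑ k, c k * Real.log (0 + 1))) := by
      refine tendsto_finsetSum _ fun k _ => Filter.Tendsto.const_mul _ ?_
      refine Filter.Tendsto.log ?_ (by norm_num)
      exact (Filter.Tendsto.div_atTop tendsto_const_nhds Filter.tendsto_id).add_const 1
    simp only [zero_add, Real.log_one, mul_zero, Finset.sum_const_zero] at h1
    refine h1.congr' ?_
    filter_upwards [Filter.eventually_gt_atTop 0] with t ht
    have h2 : ∀ k, c k * Real.log (x k / t + 1) = c k * Real.log (x k + t) - c k * Real.log t := by
      intro k
      have := hx k
      rw [div_add_one ht.ne', Real.log_div (by positivity) ht.ne']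
      ring
    simp only [h2, Finset.sum_sub_distrib, ← Finset.sum_mul, hc, zero_mul, sub_zero, hG]
  have h0 : G 0 ≤ 0 := by
    refine ge_of_tendsto hlim ?_
    filter_upwards [Filter.eventually_ge_atTop 0] with t ht
    exact hmono (Set.mem_Ici.2 le_rfl) ht ht
  simpa [hG] using h0

section RelativeEntropy

variable {n m : Type} [Fintype n] [DecidableEq n] [Fintype m] [DecidableEq m]

/-- The quadratic functional whose supremum over `Y` is
`Tr ρ† (L_σ + t R_ρ)⁻¹ ρ`. -/
noncomputable def resolventForm (ρ σ : Matrix n n ℂ) (t : ℝ) (Y : Matrix n n ℂ) : ℝ :=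
  2 * (Yᴴ * ρ).trace.re - (σ * (Y * Yᴴ)).trace.re - t * (ρ * (Yᴴ * Y)).trace.re

theorem resolventForm_diagonalization {U V : Matrix n n ℂ} (hU : Uᴴ * U = 1) (hV : Vᴴ * V = 1)
    (p q : n → ℝ) (t : ℝ) (Z : Matrix n n ℂ) :
    resolventForm (U * Matrix.diagonal (fun i => (p i : ℂ)) * Uᴴ)
        (V * Matrix.diagonal (fun i => (q i : ℂ)) * Vᴴ) t (V * Z * Uᴴ) =
      ∑ j, ∑ i, (2 * p i * (star (Z j i) * (Vᴴ * U) j i).re -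
        (q j + t * p i) * ‖Z j i‖ ^ 2) := by
  have h1 : ((V * Z * Uᴴ)ᴴ * (U * Matrix.diagonal (fun i => (p i : ℂ)) * Uᴴ)).trace =
      (Zᴴ * ((Vᴴ * U) * Matrix.diagonal (fun i => (p i : ℂ)))).trace := by
    simp only [Matrix.conjTranspose_mul, Matrix.conjTranspose_conjTranspose, Matrix.mul_assoc]
    rw [Matrix.trace_mul_comm]
    simp only [Matrix.mul_assoc, hU, Matrix.mul_one]
  have h2 : (V * Matrix.diagonal (fun i => (q i : ℂ)) * Vᴴ *
      ((V * Z * Uᴴ) * (V * Z * Uᴴ)ᴴ)).trace =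
      (Matrix.diagonal (fun i => (q i : ℂ)) * (Z * Zᴴ)).trace := by
    simp only [Matrix.conjTranspose_mul, Matrix.conjTranspose_conjTranspose, Matrix.mul_assoc]
    rw [← Matrix.mul_assoc Uᴴ, hU, Matrix.one_mul, ← Matrix.mul_assoc Vᴴ, hV, Matrix.one_mul,
      Matrix.trace_mul_comm]
    simp only [Matrix.mul_assoc, hV, Matrix.mul_one]
  have h3 : (U * Matrix.diagonal (fun i => (p i : ℂ)) * Uᴴ *
      ((V * Z * Uᴴ)ᴴ * (V * Z * Uᴴ))).trace =
      (Matrix.diagonal (fun i => (p i : ℂ)) * (Zᴴ * Z)).trace := by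
    simp only [Matrix.conjTranspose_mul, Matrix.conjTranspose_conjTranspose, Matrix.mul_assoc]
    rw [← Matrix.mul_assoc Vᴴ, hV, Matrix.one_mul, ← Matrix.mul_assoc Uᴴ, hU, Matrix.one_mul,
      Matrix.trace_mul_comm]
    simp only [Matrix.mul_assoc, hU, Matrix.mul_one]
  have e1 : (Zᴴ * ((Vᴴ * U) * Matrix.diagonal (fun i => (p i : ℂ)))).trace.re =
      ∑ j, ∑ i, p i * (star (Z j i) * (Vᴴ * U) j i).re := by
    rw [Finset.sum_comm, Matrix.trace, Complex.re_sum]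
    refine Finset.sum_congr rfl fun i _ => ?_
    rw [Matrix.diag_apply, Matrix.mul_apply, Complex.re_sum]
    refine Finset.sum_congr rfl fun j _ => ?_
    rw [Matrix.mul_diagonal, Matrix.conjTranspose_apply, ← mul_assoc, Complex.re_mul_ofReal,
      mul_comm]
  have e2 : (Matrix.diagonal (fun i => (q i : ℂ)) * (Z * Zᴴ)).trace.re =
      ∑ j, ∑ i, q j * ‖Z j i‖ ^ 2 := by
    rw [Matrix.trace, Complex.re_sum]
    refine Finset.sum_congr rfl fun j _ => ?_
    rw [Matrix.diag_apply, Matrix.diagonal_mul, Complex.re_ofReal_mul, Matrix.mul_apply,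
      Complex.re_sum, Finset.mul_sum]
    refine Finset.sum_congr rfl fun i _ => ?_
    rw [Matrix.conjTranspose_apply, Complex.star_def, Complex.mul_conj, Complex.normSq_eq_norm_sq,
      Complex.ofReal_re]
  have e3 : (Matrix.diagonal (fun i => (p i : ℂ)) * (Zᴴ * Z)).trace.re =
      ∑ j, ∑ i, p i * ‖Z j i‖ ^ 2 := by
    rw [Finset.sum_comm, Matrix.trace, Complex.re_sum]
    refine Finset.sum_congr rfl fun i _ => ?_
    rw [Matrix.diag_apply, Matrix.diagonal_mul, Complex.re_ofReal_mul, Matrix.mul_apply,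
      Complex.re_sum, Finset.mul_sum]
    refine Finset.sum_congr rfl fun j _ => ?_
    rw [Matrix.conjTranspose_apply, mul_comm (star _), Complex.star_def, Complex.mul_conj,
      Complex.normSq_eq_norm_sq, Complex.ofReal_re]
  rw [resolventForm, h1, h2, h3, e1, e2, e3]
  simp only [Finset.mul_sum, ← Finset.sum_sub_distrib]
  refine Finset.sum_congr rfl fun j _ => Finset.sum_congr rfl fun i _ => ?_
  ring

theorem resolventForm_le {U V : Matrix n n ℂ} (hU : Uᴴ * U = 1) (hU' : U * Uᴴ = 1)
    (hV : Vᴴ * V = 1) (hV' : V * Vᴴ = 1) {p q : n → ℝ} (hp : ∀ i, 0 ≤ p i)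
    (hq : ∀ i, 0 ≤ q i) {t : ℝ} (ht : 0 < t) (Y : Matrix n n ℂ) :
    resolventForm (U * Matrix.diagonal (fun i => (p i : ℂ)) * Uᴴ)
        (V * Matrix.diagonal (fun i => (q i : ℂ)) * Vᴴ) t Y ≤
      ∑ j, ∑ i, p i ^ 2 * ‖(Vᴴ * U) j i‖ ^ 2 / (q j + t * p i) := by
  have hY : Y = V * (Vᴴ * Y * U) * Uᴴ := by
    simp only [← Matrix.mul_assoc, hV', Matrix.one_mul]
    rw [Matrix.mul_assoc, hU', Matrix.mul_one]
  rw [hY, resolventForm_diagonalization hU hV]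
  generalize Vᴴ * Y * U = Z
  refine Finset.sum_le_sum fun j _ => Finset.sum_le_sum fun i _ => ?_
  have hre : (star (Z j i) * (Vᴴ * U) j i).re ≤ ‖Z j i‖ * ‖(Vᴴ * U) j i‖ := by
    refine (Complex.re_le_norm _).trans ?_
    rw [norm_mul, norm_star]
  have hpi := hp i
  have hqj := hq j
  rcases hpi.eq_or_lt with h0 | h0
  · rw [← h0]
    simp
    positivity
  · have hd : 0 < q j + t * p i := by positivity
    rw [le_div_iff₀ hd]
    have h1 : 2 * p i * (star (Z j i) * (Vᴴ * U) j i).re ≤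
        2 * p i * (‖Z j i‖ * ‖(Vᴴ * U) j i‖) := by gcongr
    nlinarith [sq_nonneg (p i * ‖(Vᴴ * U) j i‖ - (q j + t * p i) * ‖Z j i‖),
      mul_le_mul_of_nonneg_right h1 hd.le]

theorem exists_resolventForm_eq {U V : Matrix n n ℂ} (hU : Uᴴ * U = 1)
    (hV : Vᴴ * V = 1) {p q : n → ℝ} (hp : ∀ i, 0 ≤ p i)
    (hq : ∀ i, 0 ≤ q i) {t : ℝ} (ht : 0 < t) :
    ∃ Y, resolventForm (U * Matrix.diagonal (fun i => (p i : ℂ)) * Uᴴ)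
        (V * Matrix.diagonal (fun i => (q i : ℂ)) * Vᴴ) t Y =
      ∑ j, ∑ i, p i ^ 2 * ‖(Vᴴ * U) j i‖ ^ 2 / (q j + t * p i) := by
  refine ⟨V * Matrix.of (fun j i => ((p i / (q j + t * p i) : ℝ) : ℂ) * (Vᴴ * U) j i) * Uᴴ, ?_⟩
  rw [resolventForm_diagonalization hU hV]
  refine Finset.sum_congr rfl fun j _ => Finset.sum_congr rfl fun i _ => ?_
  have hpi := hp i
  have hqj := hq j
  rw [Matrix.of_apply]
  generalize (Vᴴ * U) j i = w
  simp only [star_mul', Complex.star_def, Complex.conj_ofReal, norm_mul,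
    Complex.norm_real, mul_assoc]
  rw [Complex.re_ofReal_mul, mul_comm (starRingEnd ℂ w), Complex.mul_conj,
    Complex.normSq_eq_norm_sq, Complex.ofReal_re, Real.norm_eq_abs, mul_pow, sq_abs]
  rcases hpi.eq_or_lt with h0 | h0
  · rw [← h0]; simp
  · have hd : 0 < q j + t * p i := by positivity
    field_simp
    ring

end RelativeEntropy

namespace KrausFamily

/-- The adjoint (Heisenberg picture) map `Y ↦ Σ Kᵢ† Y Kᵢ`. -/
noncomputable def adjointMap (N : KrausFamily A B) (Y : Matrix B B ℂ) : Matrix A A ℂ :=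
  ∑ i, (N.K i)ᴴ * Y * N.K i

theorem conjTranspose_adjointMap (N : KrausFamily A B) (Y : Matrix B B ℂ) :
    (N.adjointMap Y)ᴴ = N.adjointMap Yᴴ := by
  simp [adjointMap, Matrix.conjTranspose_sum, Matrix.mul_assoc]

theorem trace_apply_mul (N : KrausFamily A B) (ρ : Matrix A A ℂ) (Y : Matrix B B ℂ) :
    (N.apply ρ * Y).trace = (ρ * N.adjointMap Y).trace := by
  simp only [apply, adjointMap, Finset.sum_mul, Finset.mul_sum, Matrix.trace_sum]
  refine Finset.sum_congr rfl fun i _ => ?_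
  rw [Matrix.mul_assoc, Matrix.mul_assoc, Matrix.trace_mul_comm]
  simp only [Matrix.mul_assoc]

theorem trace_apply (N : KrausFamily A B) (hN : N.IsChannel) (ρ : Matrix A A ℂ) :
    (N.apply ρ).trace = ρ.trace := by
  have h := N.trace_apply_mul ρ 1
  have h1 : N.adjointMap 1 = 1 := by simpa [adjointMap, IsChannel] using hN
  simpa [h1] using h

theorem posSemidef_apply (N : KrausFamily A B) {ρ : Matrix A A ℂ} (hρ : ρ.PosSemidef) :
    (N.apply ρ).PosSemidef :=
  Matrix.posSemidef_sum _ fun i _ => hρ.mul_mul_conjTranspose_same (N.K i)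

theorem isDensity_apply (N : KrausFamily A B) (hN : N.IsChannel) {ρ : Matrix A A ℂ}
    (hρ : IsDensity ρ) : IsDensity (N.apply ρ) :=
  ⟨N.posSemidef_apply hρ.1, (N.trace_apply hN ρ).trans hρ.2⟩

/-- The Kadison–Schwarz inequality, tested against a positive semidefinite matrix. -/
theorem trace_mul_adjointMap_le (N : KrausFamily A B) (hN : N.IsChannel) {σ : Matrix A A ℂ}
    (hσ : σ.PosSemidef) (Y : Matrix B B ℂ) :
    (σ * (N.adjointMap Y * (N.adjointMap Y)ᴴ)).trace.re ≤ (N.apply σ * (Y * Yᴴ)).trace.re := by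
  set Z := N.adjointMap Y with hZ
  have hZ' : Zᴴ = N.adjointMap Yᴴ := N.conjTranspose_adjointMap Y
  have key : N.adjointMap (Y * Yᴴ) - Z * Zᴴ =
      ∑ i, (Yᴴ * N.K i - N.K i * Zᴴ)ᴴ * (Yᴴ * N.K i - N.K i * Zᴴ) := by
    have h1 : ∀ i, (Yᴴ * N.K i - N.K i * Zᴴ)ᴴ * (Yᴴ * N.K i - N.K i * Zᴴ) =
        (N.K i)ᴴ * (Y * Yᴴ) * N.K i - ((N.K i)ᴴ * Y * N.K i) * Zᴴ
          - Z * ((N.K i)ᴴ * Yᴴ * N.K i) + Z * ((N.K i)ᴴ * N.K i) * Zᴴ := by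
      intro i
      simp only [Matrix.conjTranspose_sub, Matrix.conjTranspose_mul,
        Matrix.conjTranspose_conjTranspose, Matrix.sub_mul, Matrix.mul_sub, Matrix.mul_assoc]
      abel
    simp only [h1, Finset.sum_add_distrib, Finset.sum_sub_distrib, ← Finset.sum_mul,
      ← Finset.mul_sum]
    have h2 : ∑ i, (N.K i)ᴴ * N.K i = 1 := hN
    have h3 : ∑ i, (N.K i)ᴴ * Y * N.K i = Z := rfl
    have h4 : ∑ i, (N.K i)ᴴ * Yᴴ * N.K i = Zᴴ := hZ'.symm
    rw [h2, h3, h4, Matrix.mul_one, adjointMap]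
    abel
  have hpos : 0 ≤ (σ * (N.adjointMap (Y * Yᴴ) - Z * Zᴴ)).trace := by
    rw [key, Finset.mul_sum, Matrix.trace_sum]
    refine Finset.sum_nonneg fun i _ => ?_
    rw [← Matrix.mul_assoc, Matrix.trace_mul_comm, ← Matrix.mul_assoc]
    exact (hσ.mul_mul_conjTranspose_same _).trace_nonneg
  have hre := (Complex.le_def.1 hpos).1
  rw [Matrix.mul_sub, Matrix.trace_sub, Complex.sub_re, Complex.zero_re] at hre
  rw [trace_apply_mul]
  linarith

theorem resolventForm_apply_le (N : KrausFamily A B) (hN : N.IsChannel) {ρ σ : Matrix A A ℂ}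
    (hρ : ρ.PosSemidef) (hσ : σ.PosSemidef) {t : ℝ} (ht : 0 ≤ t) (Y : Matrix B B ℂ) :
    resolventForm (N.apply ρ) (N.apply σ) t Y ≤ resolventForm ρ σ t (N.adjointMap Y) := by
  have h1 := N.trace_mul_adjointMap_le hN hσ Y
  have h2 := N.trace_mul_adjointMap_le hN hρ Yᴴ
  rw [← N.conjTranspose_adjointMap, Matrix.conjTranspose_conjTranspose,
    Matrix.conjTranspose_conjTranspose] at h2
  have h3 : (Yᴴ * N.apply ρ).trace = ((N.adjointMap Y)ᴴ * ρ).trace := by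
    rw [Matrix.trace_mul_comm, trace_apply_mul, Matrix.trace_mul_comm, conjTranspose_adjointMap]
  have h4 := mul_le_mul_of_nonneg_left h2 ht
  rw [resolventForm, resolventForm, h3]
  linarith

end KrausFamily

section RelativeEntropy

variable {n : Type} [Fintype n] [DecidableEq n]

theorem diag_conj_diagonalization {m : Type} (U : Matrix n n ℂ) (V : Matrix n m ℂ) (p : n → ℝ)
    (j : m) :
    ((Vᴴ * (U * Matrix.diagonal (fun i => (p i : ℂ)) * Uᴴ) * V) j j).re =
      ∑ i, ‖(Vᴴ * U) j i‖ ^ 2 * p i := by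
  have h : Vᴴ * (U * Matrix.diagonal (fun i => (p i : ℂ)) * Uᴴ) * V =
      (Vᴴ * U) * Matrix.diagonal (fun i => (p i : ℂ)) * (Vᴴ * U)ᴴ := by
    simp only [Matrix.conjTranspose_mul, Matrix.conjTranspose_conjTranspose, Matrix.mul_assoc]
  rw [h, Matrix.mul_apply, Complex.re_sum]
  refine Finset.sum_congr rfl fun i _ => ?_
  rw [Matrix.mul_diagonal, Matrix.conjTranspose_apply, mul_right_comm, Complex.star_def,
    Complex.mul_conj, Complex.normSq_eq_norm_sq, ← Complex.ofReal_mul, Complex.ofReal_re]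

theorem sum_norm_sq_mul_eq_trace (U : Matrix n n ℂ) {V : Matrix n n ℂ} (hV : V * Vᴴ = 1)
    (p : n → ℝ) :
    ∑ j, ∑ i, ‖(Vᴴ * U) j i‖ ^ 2 * p i =
      (U * Matrix.diagonal (fun i => (p i : ℂ)) * Uᴴ).trace.re := by
  simp only [← diag_conj_diagonalization]
  rw [← Complex.re_sum]
  change (Vᴴ * (U * Matrix.diagonal (fun i => (p i : ℂ)) * Uᴴ) * V).trace.re = _
  rw [Matrix.trace_mul_comm, ← Matrix.mul_assoc, hV, Matrix.one_mul]

/-- Monotonicity of the relative entropy under quantum channels, in terms of diagonalizations. -/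
theorem KrausFamily.relEntropy_apply_le (N : KrausFamily A B) (hN : N.IsChannel)
    {U V : Matrix A A ℂ} {U' V' : Matrix B B ℂ} {p q : A → ℝ} {p' q' : B → ℝ}
    (hU : Uᴴ * U = 1) (hU₂ : U * Uᴴ = 1) (hV : Vᴴ * V = 1) (hV₂ : V * Vᴴ = 1)
    (hU' : U'ᴴ * U' = 1) (hV' : V'ᴴ * V' = 1) (hV'₂ : V' * V'ᴴ = 1)
    (hp : ∀ i, 0 ≤ p i) (hq : ∀ i, 0 ≤ q i) (hp' : ∀ i, 0 ≤ p' i) (hq' : ∀ i, 0 ≤ q' i)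
    (hNρ : N.apply (U * Matrix.diagonal (fun i => (p i : ℂ)) * Uᴴ) =
      U' * Matrix.diagonal (fun i => (p' i : ℂ)) * U'ᴴ)
    (hNσ : N.apply (V * Matrix.diagonal (fun i => (q i : ℂ)) * Vᴴ) =
      V' * Matrix.diagonal (fun i => (q' i : ℂ)) * V'ᴴ)
    (hs : ∀ j i, q j = 0 → ‖(Vᴴ * U) j i‖ ^ 2 * p i = 0)
    (hs' : ∀ j i, q' j = 0 → ‖(V'ᴴ * U') j i‖ ^ 2 * p' i = 0) :
    ∑ j, ∑ i, ‖(V'ᴴ * U') j i‖ ^ 2 * p' i * (Real.log (p' i) - Real.log (q' j)) ≤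
      ∑ j, ∑ i, ‖(Vᴴ * U) j i‖ ^ 2 * p i * (Real.log (p i) - Real.log (q j)) := by
  have hpos : ∀ {k : Type} [Fintype k] [DecidableEq k] (W : Matrix k k ℂ) (r : k → ℝ),
      (∀ i, 0 ≤ r i) → (W * Matrix.diagonal (fun i => (r i : ℂ)) * Wᴴ).PosSemidef := by
    intro k _ _ W r hr
    refine Matrix.PosSemidef.mul_mul_conjTranspose_same ?_ W
    rw [Matrix.posSemidef_diagonal_iff]
    exact fun i => Complex.zero_le_real.2 (hr i)
  have hF : ∀ t : ℝ, 0 < t →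
      ∑ j, ∑ i, p' i ^ 2 * ‖(V'ᴴ * U') j i‖ ^ 2 / (q' j + t * p' i) ≤
        ∑ j, ∑ i, p i ^ 2 * ‖(Vᴴ * U) j i‖ ^ 2 / (q j + t * p i) := by
    intro t ht
    obtain ⟨Y, hY⟩ := exists_resolventForm_eq hU' hV' hp' hq' ht
    rw [← hY, ← hNρ, ← hNσ]
    exact (N.resolventForm_apply_le hN (hpos U p hp) (hpos V q hq) ht.le Y).trans
      (resolventForm_le hU hU₂ hV hV₂ hp hq ht _)
  have hterm : ∀ (w a b t : ℝ), 0 ≤ a → 0 ≤ b → (b = 0 → w ^ 2 * a = 0) → 0 < t →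
      w ^ 2 * a / ((if 0 < a ∧ 0 < b then b / a else 1) + t) = a ^ 2 * w ^ 2 / (b + t * a) := by
    intro w a b t ha hb h ht
    rcases ha.eq_or_lt with h0 | h0
    · rw [← h0]; simp
    rcases hb.eq_or_lt with h1 | h1
    · have hw : w = 0 := by
        have := h h1.symm
        simpa [h0.ne'] using this
      simp [hw]
    rw [if_pos ⟨h0, h1⟩]
    field_simp
  have hlog : ∀ (w a b : ℝ), 0 ≤ a → 0 ≤ b → (b = 0 → w ^ 2 * a = 0) →
      w ^ 2 * a * Real.log (if 0 < a ∧ 0 < b then b / a else 1) =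
        -(w ^ 2 * a * (Real.log a - Real.log b)) := by
    intro w a b ha hb h
    rcases ha.eq_or_lt with h0 | h0
    · rw [← h0]; simp
    rcases hb.eq_or_lt with h1 | h1
    · rw [h h1.symm]; simp
    rw [if_pos ⟨h0, h1⟩, Real.log_div h1.ne' h0.ne']
    ring
  have hmain := sum_mul_log_nonpos
    (κ := (A × A) ⊕ (B × B))
    (Sum.elim (fun k => ‖(Vᴴ * U) k.1 k.2‖ ^ 2 * p k.2)
      (fun k => -(‖(V'ᴴ * U') k.1 k.2‖ ^ 2 * p' k.2)))
    (Sum.elim (fun k => if 0 < p k.2 ∧ 0 < q k.1 then q k.1 / p k.2 else 1)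
      (fun k => if 0 < p' k.2 ∧ 0 < q' k.1 then q' k.1 / p' k.2 else 1)) ?_ ?_ ?_
  · simp only [Fintype.sum_sum_type, Sum.elim_inl, Sum.elim_inr, Fintype.sum_prod_type,
      neg_mul, Finset.sum_neg_distrib] at hmain
    simp only [hlog _ _ _ (hp _) (hq _) (hs _ _), hlog _ _ _ (hp' _) (hq' _) (hs' _ _),
      Finset.sum_neg_distrib] at hmain
    linarith
  · rintro (k | k)
    · simp only [Sum.elim_inl]
      split_ifs with h
      · exact div_pos h.2 h.1
      · exact one_pos
    · simp only [Sum.elim_inr]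
      split_ifs with h
      · exact div_pos h.2 h.1
      · exact one_pos
  · simp only [Fintype.sum_sum_type, Sum.elim_inl, Sum.elim_inr, Fintype.sum_prod_type,
      Finset.sum_neg_distrib]
    rw [sum_norm_sq_mul_eq_trace U hV₂, sum_norm_sq_mul_eq_trace U' hV'₂, ← hNρ,
      N.trace_apply hN]
    ring
  · intro t ht
    simp only [Fintype.sum_sum_type, Sum.elim_inl, Sum.elim_inr, Fintype.sum_prod_type,
      neg_div, Finset.sum_neg_distrib]
    simp only [hterm _ _ _ t (hp _) (hq _) (hs _ _) ht, hterm _ _ _ t (hp' _) (hq' _) (hs' _ _) ht]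
    linarith [hF t ht]

end RelativeEntropy

/-- The marginal of a bipartite matrix on the second system. -/
def marginal {X : Type} [Fintype X] (ρ : Matrix (X × A) (X × A) ℂ) : Matrix A A ℂ :=
  ∑ x, ρ.submatrix (Prod.mk x) (Prod.mk x)

theorem posSemidef_marginal {X : Type} [Fintype X] {ρ : Matrix (X × A) (X × A) ℂ}
    (h : ρ.PosSemidef) : (marginal ρ).PosSemidef :=
  Matrix.posSemidef_sum _ fun x _ => h.submatrix (Prod.mk x)

theorem trace_marginal {X : Type} [Fintype X] (ρ : Matrix (X × A) (X × A) ℂ) :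
    (marginal ρ).trace = ρ.trace := by
  simp [marginal, Matrix.trace, Matrix.sum_apply, Fintype.sum_prod_type]
  exact Finset.sum_comm

theorem isDensity_marginal {X : Type} [Fintype X] {ρ : Matrix (X × A) (X × A) ℂ}
    (h : IsDensity ρ) : IsDensity (marginal ρ) :=
  ⟨posSemidef_marginal h.1, (trace_marginal ρ).trans h.2⟩

namespace KrausFamily

/-- The channel `id ⊗ N` on a bipartite system. -/
noncomputable def ext (X : Type) [Fintype X] [DecidableEq X] (N : KrausFamily A B) :
    KrausFamily (X × A) (X × B) where
  ι := N.ι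
  K i := (1 : Matrix X X ℂ) ⊗ₖ N.K i

/-- The Kraus family with a single Kraus operator. -/
def single (K : Matrix B A ℂ) : KrausFamily A B where
  ι := Unit
  K _ := K

@[simp]
theorem single_apply (K : Matrix B A ℂ) (ρ : Matrix A A ℂ) :
    (single K).apply ρ = K * ρ * Kᴴ :=
  Fintype.sum_unique (ι := Unit) _

theorem single_isChannel {K : Matrix B A ℂ} (hK : Kᴴ * K = 1) : (single K).IsChannel :=
  (Fintype.sum_unique (ι := Unit) _).trans hK

theorem apply_apply (N : KrausFamily A B) (ρ : Matrix A A ℂ) (b b' : B) :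
    N.apply ρ b b' = ∑ i, ∑ a, ∑ a', N.K i b a * star (N.K i b' a') * ρ a a' := by
  rw [apply, Matrix.sum_apply]
  refine Finset.sum_congr rfl fun i _ => ?_
  rw [Matrix.mul_apply, Finset.sum_comm]
  refine Finset.sum_congr rfl fun a' _ => ?_
  rw [Matrix.mul_apply, Finset.sum_mul]
  refine Finset.sum_congr rfl fun a _ => ?_
  rw [Matrix.conjTranspose_apply]
  ring

theorem apply_sum (N : KrausFamily A B) {κ : Type} (s : Finset κ) (ρ : κ → Matrix A A ℂ) :
    N.apply (∑ k ∈ s, ρ k) = ∑ k ∈ s, N.apply (ρ k) := by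
  simp only [apply, Matrix.mul_sum, Matrix.sum_mul]
  exact Finset.sum_comm

theorem apply_smul (N : KrausFamily A B) (c : ℂ) (ρ : Matrix A A ℂ) :
    N.apply (c • ρ) = c • N.apply ρ := by
  simp [apply, Finset.smul_sum]

variable {X : Type} [Fintype X] [DecidableEq X]

theorem isChannel_ext {N : KrausFamily A B} (hN : N.IsChannel) : (N.ext X).IsChannel := by
  change ∑ i, ((1 : Matrix X X ℂ) ⊗ₖ N.K i)ᴴ * ((1 : Matrix X X ℂ) ⊗ₖ N.K i) = 1
  simp only [Matrix.conjTranspose_kronecker, ← Matrix.mul_kronecker_mul,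
    Matrix.conjTranspose_one, Matrix.mul_one]
  rw [← Matrix.one_kronecker_one, ← (show ∑ i, (N.K i)ᴴ * N.K i = 1 from hN)]
  ext i j
  simp [Matrix.sum_apply, Matrix.kroneckerMap_apply, Finset.mul_sum]

theorem ext_apply_submatrix (N : KrausFamily A B) (ρ : Matrix (X × A) (X × A) ℂ) (x x' : X) :
    ((N.ext X).apply ρ).submatrix (Prod.mk x) (Prod.mk x') =
      N.apply (ρ.submatrix (Prod.mk x) (Prod.mk x')) := by
  ext b b'
  rw [Matrix.submatrix_apply, apply_apply, apply_apply]
  refine Finset.sum_congr rfl fun i _ => ?_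
  simp only [ext, Fintype.sum_prod_type, Matrix.kroneckerMap_apply, Matrix.one_apply, ite_mul,
    one_mul, zero_mul, apply_ite star, star_zero, mul_ite, mul_zero, Matrix.submatrix_apply]
  rw [Finset.sum_eq_single x (by simp +contextual [eq_comm]) (by simp)]
  refine Finset.sum_congr rfl fun a _ => ?_
  rw [Finset.sum_eq_single x' (by simp +contextual [eq_comm]) (by simp)]
  simp

theorem ext_apply_apply (N : KrausFamily A B) (ρ : Matrix (X × A) (X × A) ℂ) (x x' : X)
    (b b' : B) :
    (N.ext X).apply ρ (x, b) (x', b') = N.apply (ρ.submatrix (Prod.mk x) (Prod.mk x')) b b' := by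
  rw [← ext_apply_submatrix]
  rfl

theorem marginal_ext_apply (N : KrausFamily A B) (ρ : Matrix (X × A) (X × A) ℂ) :
    marginal ((N.ext X).apply ρ) = N.apply (marginal ρ) := by
  simp only [marginal, apply_sum, ext_apply_submatrix]

theorem ext_apply_one_kronecker (N : KrausFamily A B) (σ : Matrix A A ℂ) :
    (N.ext X).apply ((1 : Matrix X X ℂ) ⊗ₖ σ) = 1 ⊗ₖ N.apply σ := by
  ext ⟨x, b⟩ ⟨x', b'⟩
  rw [ext_apply_apply]
  have : ((1 : Matrix X X ℂ) ⊗ₖ σ).submatrix (Prod.mk x) (Prod.mk x') =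
      (1 : Matrix X X ℂ) x x' • σ := by
    ext a a'
    simp [Matrix.kroneckerMap_apply]
  rw [this, apply_smul]
  simp [Matrix.kroneckerMap_apply]

end KrausFamily

section ConditionalEntropy

variable {X : Type} [Fintype X] [DecidableEq X]

theorem sum_overlap_eq_marginal {U : Matrix (X × A) (X × A) ℂ} {V : Matrix A A ℂ}
    {p : X × A → ℝ} {q : A → ℝ} (hV : Vᴴ * V = 1)
    (hm : marginal (U * Matrix.diagonal (fun i => (p i : ℂ)) * Uᴴ) =
      V * Matrix.diagonal (fun i => (q i : ℂ)) * Vᴴ) (k : A) :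
    ∑ x, ∑ i, ‖(((1 : Matrix X X ℂ) ⊗ₖ V)ᴴ * U) (x, k) i‖ ^ 2 * p i = q k := by
  simp only [← diag_conj_diagonalization]
  have h := (KrausFamily.single Vᴴ).marginal_ext_apply
    (X := X) (U * Matrix.diagonal (fun i => (p i : ℂ)) * Uᴴ)
  rw [hm, KrausFamily.single_apply, Matrix.conjTranspose_conjTranspose] at h
  have h1 : ((KrausFamily.single Vᴴ).ext X).apply
      (U * Matrix.diagonal (fun i => (p i : ℂ)) * Uᴴ) =
      ((1 : Matrix X X ℂ) ⊗ₖ V)ᴴ * (U * Matrix.diagonal (fun i => (p i : ℂ)) * Uᴴ) *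
        ((1 : Matrix X X ℂ) ⊗ₖ V) := by
    refine (Fintype.sum_unique (ι := Unit) _).trans ?_
    simp [KrausFamily.ext, KrausFamily.single, Matrix.conjTranspose_kronecker]
  have h2 : Vᴴ * (V * Matrix.diagonal (fun i => (q i : ℂ)) * Vᴴ) * V =
      Matrix.diagonal (fun i => (q i : ℂ)) := by
    simp only [← Matrix.mul_assoc, hV, Matrix.one_mul]
    rw [Matrix.mul_assoc, hV, Matrix.mul_one]
  rw [h1, h2] at h
  have h3 := congrArg (fun M => (M k k).re) h
  simpa [marginal, Matrix.sum_apply] using h3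

theorem relEntropy_one_kronecker_marginal {U : Matrix (X × A) (X × A) ℂ} {V : Matrix A A ℂ}
    {p : X × A → ℝ} {q : A → ℝ} (hU : Uᴴ * U = 1) (hV : Vᴴ * V = 1) (hV₂ : V * Vᴴ = 1)
    (hm : marginal (U * Matrix.diagonal (fun i => (p i : ℂ)) * Uᴴ) =
      V * Matrix.diagonal (fun i => (q i : ℂ)) * Vᴴ) :
    ∑ j, ∑ i, ‖(((1 : Matrix X X ℂ) ⊗ₖ V)ᴴ * U) j i‖ ^ 2 * p i *
        (Real.log (p i) - Real.log (q j.2)) =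
      Real.log 2 * (vnEntropy (marginal (U * Matrix.diagonal (fun i => (p i : ℂ)) * Uᴴ)) -
        vnEntropy (U * Matrix.diagonal (fun i => (p i : ℂ)) * Uᴴ)) := by
  have hl : Real.log 2 ≠ 0 := (Real.log_pos one_lt_two).ne'
  have hW : ∀ i, ∑ j, ‖(((1 : Matrix X X ℂ) ⊗ₖ V)ᴴ * U) j i‖ ^ 2 = 1 := by
    intro i
    have h1 : (((1 : Matrix X X ℂ) ⊗ₖ V)ᴴ * U)ᴴ * (((1 : Matrix X X ℂ) ⊗ₖ V)ᴴ * U) = 1 := by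
      rw [Matrix.conjTranspose_mul, Matrix.conjTranspose_conjTranspose, Matrix.mul_assoc,
        ← Matrix.mul_assoc _ _ U, Matrix.conjTranspose_kronecker, ← Matrix.mul_kronecker_mul, hV₂]
      simp [hU]
    generalize ((1 : Matrix X X ℂ) ⊗ₖ V)ᴴ * U = W at h1
    have h2 := congrArg (fun M => (M i i).re) h1
    simp only [Matrix.mul_apply, Matrix.conjTranspose_apply, Matrix.one_apply_eq,
      Complex.one_re, Complex.re_sum] at h2
    rw [← h2]
    refine Finset.sum_congr rfl fun j _ => ?_
    rw [mul_comm, Complex.star_def, Complex.mul_conj, Complex.normSq_eq_norm_sq,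
      Complex.ofReal_re]
  rw [vnEntropy_eq_sum_of_diagonalization hV hm, vnEntropy_eq_sum_of_diagonalization hU rfl]
  simp only [Real.logb, mul_sub, Finset.sum_sub_distrib]
  have e1 : ∑ j, ∑ i, ‖(((1 : Matrix X X ℂ) ⊗ₖ V)ᴴ * U) j i‖ ^ 2 * p i * Real.log (p i) =
      ∑ i, p i * Real.log (p i) := by
    rw [Finset.sum_comm]
    refine Finset.sum_congr rfl fun i _ => ?_
    simp only [mul_assoc]
    rw [← Finset.sum_mul, hW, one_mul]
  have e2 : ∑ j : X × A, ∑ i, ‖(((1 : Matrix X X ℂ) ⊗ₖ V)ᴴ * U) j i‖ ^ 2 * p i *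
      Real.log (q j.2) = ∑ k, q k * Real.log (q k) := by
    rw [Fintype.sum_prod_type, Finset.sum_comm]
    refine Finset.sum_congr rfl fun k _ => ?_
    simp only [← Finset.sum_mul]
    rw [sum_overlap_eq_marginal hV hm]
  rw [e1, e2]
  simp only [mul_neg, Finset.mul_sum]
  have e3 : ∀ x : ℝ, Real.log 2 * (x * (Real.log x / Real.log 2)) = x * Real.log x := by
    intro x; field_simp
  simp only [e3]
  ring

/-- Data processing for the conditional entropy: a channel acting on the conditioning system
cannot increase `S(A) - S(XA)`. -/
theorem vnEntropy_marginal_sub_le {N : KrausFamily A B} (hN : N.IsChannel)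
    {ρ : Matrix (X × A) (X × A) ℂ} (hρ : ρ.PosSemidef) :
    vnEntropy (N.apply (marginal ρ)) - vnEntropy ((N.ext X).apply ρ) ≤
      vnEntropy (marginal ρ) - vnEntropy ρ := by
  obtain ⟨U, p, hU₂, hU, hp, hρd⟩ := hρ.exists_diagonalization
  obtain ⟨V, q, hV₂, hV, hq, hmd⟩ := (posSemidef_marginal hρ).exists_diagonalization
  obtain ⟨U', p', hU'₂, hU', hp', hρd'⟩ := ((N.ext X).posSemidef_apply hρ).exists_diagonalization
  obtain ⟨V', q', hV'₂, hV', hq', hmd'⟩ :=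
    (N.posSemidef_apply (posSemidef_marginal hρ)).exists_diagonalization
  have hk : ∀ {C : Type} [Fintype C] [DecidableEq C] {W W' : Matrix C C ℂ}, W * W' = 1 →
      ((1 : Matrix X X ℂ) ⊗ₖ W) * ((1 : Matrix X X ℂ) ⊗ₖ W') = 1 := by
    intro C _ _ W W' h
    rw [← Matrix.mul_kronecker_mul, h, Matrix.one_mul, Matrix.one_kronecker_one]
  have hd : ∀ {C : Type} [Fintype C] [DecidableEq C] (W : Matrix C C ℂ) (r : C → ℝ),
      ((1 : Matrix X X ℂ) ⊗ₖ W) * Matrix.diagonal (fun i : X × C => (r i.2 : ℂ)) *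
        ((1 : Matrix X X ℂ) ⊗ₖ W)ᴴ =
      1 ⊗ₖ (W * Matrix.diagonal (fun i => (r i : ℂ)) * Wᴴ) := by
    intro C _ _ W r
    have : Matrix.diagonal (fun i : X × C => (r i.2 : ℂ)) =
        (1 : Matrix X X ℂ) ⊗ₖ Matrix.diagonal (fun i => (r i : ℂ)) := by
      rw [← Matrix.diagonal_one, Matrix.diagonal_kronecker_diagonal]
      simp
    rw [this, Matrix.conjTranspose_kronecker, ← Matrix.mul_kronecker_mul,
      ← Matrix.mul_kronecker_mul]
    simp
  have hm : marginal (U * Matrix.diagonal (fun i => (p i : ℂ)) * Uᴴ) =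
      V * Matrix.diagonal (fun i => (q i : ℂ)) * Vᴴ := by rw [← hρd, hmd]
  have hm' : marginal (U' * Matrix.diagonal (fun i => (p' i : ℂ)) * U'ᴴ) =
      V' * Matrix.diagonal (fun i => (q' i : ℂ)) * V'ᴴ := by
    rw [← hρd', N.marginal_ext_apply, hmd']
  have hsupp : ∀ {C : Type} [Fintype C] [DecidableEq C] {U : Matrix (X × C) (X × C) ℂ}
      {V : Matrix C C ℂ} {p : X × C → ℝ} {q : C → ℝ}, Vᴴ * V = 1 → (∀ i, 0 ≤ p i) →
      marginal (U * Matrix.diagonal (fun i => (p i : ℂ)) * Uᴴ) =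
        V * Matrix.diagonal (fun i => (q i : ℂ)) * Vᴴ → ∀ (j i : X × C), q j.2 = 0 →
      ‖(((1 : Matrix X X ℂ) ⊗ₖ V)ᴴ * U) j i‖ ^ 2 * p i = 0 := by
    rintro C _ _ U V p q hV hp hm ⟨x, k⟩ i hj
    have h := sum_overlap_eq_marginal hV hm k
    rw [show q k = 0 from hj, Finset.sum_eq_zero_iff_of_nonneg
      (fun x _ => Finset.sum_nonneg fun i _ => mul_nonneg (sq_nonneg _) (hp i))] at h
    have h2 := h x (Finset.mem_univ _)
    rw [Finset.sum_eq_zero_iff_of_nonneg (fun i _ => mul_nonneg (sq_nonneg _) (hp i))] at h2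
    exact h2 i (Finset.mem_univ _)
  have key := (N.ext X).relEntropy_apply_le (KrausFamily.isChannel_ext hN)
    (U := U) (V := 1 ⊗ₖ V) (U' := U') (V' := 1 ⊗ₖ V') (p := p) (q := fun i => q i.2)
    (p' := p') (q' := fun i => q' i.2) hU hU₂
    (by rw [Matrix.conjTranspose_kronecker, Matrix.conjTranspose_one]; exact hk hV)
    (by rw [Matrix.conjTranspose_kronecker, Matrix.conjTranspose_one]; exact hk hV₂)
    hU'
    (by rw [Matrix.conjTranspose_kronecker, Matrix.conjTranspose_one]; exact hk hV')
    (by rw [Matrix.conjTranspose_kronecker, Matrix.conjTranspose_one]; exact hk hV'₂)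
    hp (fun i => hq _) hp' (fun i => hq' _)
    (by rw [← hρd, ← hρd'])
    (by rw [hd, hd, KrausFamily.ext_apply_one_kronecker, ← hmd, hmd'])
    (hsupp hV hp hm) (hsupp hV' hp' hm')
  rw [relEntropy_one_kronecker_marginal hU' hV' hV'₂ hm',
    relEntropy_one_kronecker_marginal hU hV hV₂ hm, ← hρd, ← hρd', N.marginal_ext_apply] at key
  exact le_of_mul_le_mul_left key (Real.log_pos one_lt_two)

end ConditionalEntropy

namespace KrausFamily

variable {C D E X : Type} [Fintype C] [DecidableEq C] [Fintype D] [DecidableEq D]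
  [Fintype E] [DecidableEq E] [Fintype X] [DecidableEq X]

/-- The coefficients of `N.apply` as a linear map between matrix entries. -/
noncomputable def coeff (N : KrausFamily A B) (b b' : B) (a a' : A) : ℂ :=
  ∑ i, N.K i b a * star (N.K i b' a')

theorem apply_eq_sum_coeff (N : KrausFamily A B) (ρ : Matrix A A ℂ) (b b' : B) :
    N.apply ρ b b' = ∑ q : A × A, N.coeff b b' q.1 q.2 * ρ q.1 q.2 := by
  simp only [apply_apply, coeff, Finset.sum_mul, Fintype.sum_prod_type]
  rw [Finset.sum_comm]
  refine Finset.sum_congr rfl fun a _ => ?_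
  rw [Finset.sum_comm]

theorem apply_single_eq_coeff (N : KrausFamily A B) (b b' : B) (a a' : A) :
    N.apply (Matrix.single a a' 1) b b' = N.coeff b b' a a' := by
  rw [apply_eq_sum_coeff, Finset.sum_eq_single (a, a')]
  · simp
  · rintro ⟨c, c'⟩ - h
    rw [Matrix.single_apply_of_ne, mul_zero]
    rintro ⟨rfl, rfl⟩
    exact h rfl
  · simp

theorem ext_apply_eq_sum_coeff (N : KrausFamily A B) (ρ : Matrix (X × A) (X × A) ℂ) (s s' : X × B) :
    (N.ext X).apply ρ s s' =
      ∑ q : A × A, N.coeff s.2 s'.2 q.1 q.2 * ρ (s.1, q.1) (s'.1, q.2) := by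
  obtain ⟨x, b⟩ := s
  obtain ⟨x', b'⟩ := s'
  rw [ext_apply_apply, apply_eq_sum_coeff]
  rfl

theorem apply_comp_iff (T : KrausFamily B C) (M : KrausFamily A B) (N : KrausFamily A C) :
    (∀ ρ, T.apply (M.apply ρ) = N.apply ρ) ↔ ∀ c c' a a',
      ∑ q : B × B, T.coeff c c' q.1 q.2 * M.coeff q.1 q.2 a a' = N.coeff c c' a a' := by
  constructor
  · intro h c c' a a'
    have := congrFun (congrFun (h (Matrix.single a a' 1)) c) c'
    rw [apply_eq_sum_coeff, apply_single_eq_coeff] at this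
    simpa only [apply_single_eq_coeff] using this
  · intro h ρ
    ext c c'
    rw [apply_eq_sum_coeff, apply_eq_sum_coeff]
    simp only [apply_eq_sum_coeff M, Finset.mul_sum, ← h, Finset.sum_mul]
    rw [Finset.sum_comm]
    simp only [mul_assoc]

theorem ext_apply_comp {T : KrausFamily B C} {M : KrausFamily A B}
    {N : KrausFamily A C} (h : ∀ ρ, T.apply (M.apply ρ) = N.apply ρ)
    (ρ : Matrix (X × A) (X × A) ℂ) :
    (T.ext X).apply ((M.ext X).apply ρ) = (N.ext X).apply ρ := by
  ext ⟨x, b⟩ ⟨x', b'⟩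
  rw [ext_apply_apply, ext_apply_submatrix, h, ext_apply_apply]

theorem pow_coeff (N : KrausFamily A B) (n : ℕ) (b b' : Fin n → B) (a a' : Fin n → A) :
    (N.pow n).coeff b b' a a' = ∏ i, N.coeff (b i) (b' i) (a i) (a' i) := by
  simp only [coeff]
  rw [Finset.prod_univ_sum, Fintype.piFinset_univ]
  refine Finset.sum_congr rfl fun f _ => ?_
  simp [pow, Finset.prod_mul_distrib]

theorem pow_apply_comp {T : KrausFamily B C} {M : KrausFamily A B} {N : KrausFamily A C}
    (h : ∀ ρ, T.apply (M.apply ρ) = N.apply ρ) (n : ℕ) (ρ : Matrix (Fin n → A) (Fin n → A) ℂ) :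
    (T.pow n).apply ((M.pow n).apply ρ) = (N.pow n).apply ρ := by
  revert ρ
  rw [apply_comp_iff] at h ⊢
  intro c c' a a'
  simp only [pow_coeff, ← h, ← Finset.prod_mul_distrib]
  rw [Finset.prod_univ_sum, Fintype.piFinset_univ]
  exact Fintype.sum_equiv (Equiv.arrowProdEquivProdArrow (Fin n) (fun _ => B) (fun _ => B)).symm
    _ _ fun q => rfl

theorem isChannel_iff (N : KrausFamily A B) :
    N.IsChannel ↔ ∀ a a', ∑ q : N.ι × B, star (N.K q.1 q.2 a) * N.K q.1 q.2 a' =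
      if a = a' then 1 else 0 := by
  rw [IsChannel, ← Matrix.ext_iff]
  simp [Matrix.sum_apply, Matrix.mul_apply, Matrix.one_apply, Fintype.sum_prod_type]

theorem isChannel_pow {N : KrausFamily A B} (hN : N.IsChannel) (n : ℕ) : (N.pow n).IsChannel := by
  rw [isChannel_iff] at hN ⊢
  intro a a'
  have h1 : (if a = a' then 1 else 0 : ℂ) = ∏ i, if a i = a' i then 1 else 0 := by
    simp [Finset.prod_ite_zero, funext_iff]
  rw [h1]
  simp only [← hN]
  rw [Finset.prod_univ_sum, Fintype.piFinset_univ]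
  refine Fintype.sum_equiv
    (Equiv.arrowProdEquivProdArrow (Fin n) (fun _ => N.ι) (fun _ => B)).symm _ _ fun q => ?_
  simp [pow, Finset.prod_mul_distrib]

/-- The complementary channel as a Kraus family. -/
def complFam (N : KrausFamily A B) : KrausFamily A N.ι where
  ι := B
  K b := Matrix.of fun i a => N.K i b a

theorem complFam_apply (N : KrausFamily A B) (ρ : Matrix A A ℂ) :
    N.complFam.apply ρ = N.compl ρ := by
  ext i j
  rw [apply_apply, compl, Matrix.of_apply, Matrix.trace]
  have h : ∀ b, ∑ a, ∑ a', N.K i b a * star (N.K j b a') * ρ a a' =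
      (N.K i * ρ * (N.K j)ᴴ) b b := by
    intro b
    rw [Matrix.mul_apply, Finset.sum_comm]
    refine Finset.sum_congr rfl fun a' _ => ?_
    rw [Matrix.mul_apply, Finset.sum_mul]
    refine Finset.sum_congr rfl fun a _ => ?_
    rw [Matrix.conjTranspose_apply]
    ring
  exact Finset.sum_congr rfl fun b _ => h b

theorem isChannel_complFam {N : KrausFamily A B} (hN : N.IsChannel) : N.complFam.IsChannel := by
  rw [isChannel_iff] at hN ⊢
  intro a a'
  rw [← hN a a']
  exact Fintype.sum_equiv (Equiv.prodComm _ _) _ _ fun q => rfl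

/-- The coherent information cannot increase under post-processing. -/
theorem cohInfo_le_of_apply_comp {T : KrausFamily B C} {M : KrausFamily A B} {N : KrausFamily A C}
    (hT : T.IsChannel) (h : ∀ ρ, T.apply (M.apply ρ) = N.apply ρ) {φ : Matrix A A ℂ}
    (hφ : φ.PosSemidef) : cohInfo N φ ≤ cohInfo M φ := by
  obtain ⟨G, hG⟩ : ∃ G : Matrix A A ℂ, φ = G * Gᴴ := by
    obtain ⟨U, p, -, -, hp, hU⟩ := hφ.exists_diagonalization
    refine ⟨U * Matrix.diagonal fun i => (Real.sqrt (p i) : ℂ), ?_⟩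
    have hD : (Matrix.diagonal fun i => (Real.sqrt (p i) : ℂ)) *
        (Matrix.diagonal fun i => (Real.sqrt (p i) : ℂ))ᴴ =
        Matrix.diagonal fun i => (p i : ℂ) := by
      rw [Matrix.diagonal_conjTranspose, Matrix.diagonal_mul_diagonal]
      congr 1
      ext i
      simp [← Complex.ofReal_mul, Real.mul_self_sqrt (hp i)]
    rw [Matrix.conjTranspose_mul, Matrix.mul_assoc, ← Matrix.mul_assoc _ _ Uᴴ, hD,
      ← Matrix.mul_assoc, hU]
  set ρ : Matrix (A × A) (A × A) ℂ :=
    Matrix.vecMulVec (fun r => G r.2 r.1) (star fun r => G r.2 r.1) with hρ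
  have hρpos : ρ.PosSemidef := Matrix.posSemidef_vecMulVec_self_star _
  have hmarg : marginal ρ = φ := by
    ext a a'
    simp [marginal, Matrix.sum_apply, hρ, hG, Matrix.mul_apply, Matrix.vecMulVec_apply]
  have key : ∀ {F : Type} [Fintype F] [DecidableEq F] (R : KrausFamily A F),
      vnEntropy ((R.ext A).apply ρ) = vnEntropy (R.compl φ) := by
    intro F _ _ R
    set W : Matrix (A × F) R.ι ℂ := Matrix.of fun s i => (R.K i * G) s.2 s.1 with hW
    have h1 : (R.ext A).apply ρ = W * Wᴴ := by
      ext ⟨r, b⟩ ⟨r', b'⟩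
      rw [ext_apply_apply, apply_apply, Matrix.mul_apply]
      refine Finset.sum_congr rfl fun i _ => ?_
      simp only [hW, hρ, Matrix.conjTranspose_apply, Matrix.of_apply, Matrix.mul_apply, star_sum,
        Finset.sum_mul, Finset.mul_sum, Matrix.submatrix_apply, Matrix.vecMulVec_apply,
        Pi.star_apply, star_mul']
      rw [Finset.sum_comm]
      refine Finset.sum_congr rfl fun a' _ => Finset.sum_congr rfl fun a _ => ?_
      ring
    have h2 : R.compl φ = (Wᴴ * W)ᵀ := by
      ext i j
      rw [Matrix.transpose_apply, compl, Matrix.of_apply, hG, ← Matrix.mul_assoc,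
        Matrix.mul_assoc, ← Matrix.conjTranspose_mul, Matrix.trace, Matrix.mul_apply,
        Fintype.sum_prod_type, Finset.sum_comm]
      refine Finset.sum_congr rfl fun b _ => ?_
      rw [Matrix.diag_apply, Matrix.mul_apply]
      refine Finset.sum_congr rfl fun r _ => ?_
      rw [mul_comm]
      rfl
    rw [h1, h2, vnEntropy_transpose (Matrix.isHermitian_conjTranspose_mul_self W),
      vnEntropy_mul_conjTranspose]
  have hm := vnEntropy_marginal_sub_le hT ((M.ext A).posSemidef_apply hρpos)
  rw [marginal_ext_apply, hmarg, ext_apply_comp h, key, key, h] at hm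
  exact hm

end KrausFamily

theorem IsDensity.submatrix_equiv {m n : Type} [Fintype m] [Fintype n] {ρ : Matrix n n ℂ}
    (h : IsDensity ρ) (e : m ≃ n) : IsDensity (ρ.submatrix e e) :=
  ⟨h.1.submatrix e, by rw [← h.2]; exact Fintype.sum_equiv e _ _ fun _ => rfl⟩

namespace KrausFamily

variable {C D E X : Type} [Fintype C] [DecidableEq C] [Fintype D] [DecidableEq D]
  [Fintype E] [DecidableEq E] [Fintype X] [DecidableEq X]

/-- For every state extended by an arbitrary reference system, the output entropy of `F` exceeds
the output entropy of `G` by at most `y`. -/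
def ExtendedEntropyGapLE (F : KrausFamily A B) (G : KrausFamily A E) (y : ℝ) : Prop :=
  ∀ (X : Type) [Fintype X] [DecidableEq X] (ρ : Matrix (X × A) (X × A) ℂ), IsDensity ρ →
    vnEntropy ((F.ext X).apply ρ) - vnEntropy ((G.ext X).apply ρ) ≤ y

/-- Exchanging the last two of three factors. -/
def prodRightComm (X A C : Type) : (X × A) × C ≃ (X × C) × A where
  toFun s := ((s.1.1, s.2), s.1.2)
  invFun s := ((s.1.1, s.2), s.1.2)

/-- Channels acting on different subsystems commute. -/
theorem ext_apply_rightComm (F : KrausFamily A B) (G : KrausFamily C D)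
    (ρ : Matrix ((X × A) × C) ((X × A) × C) ℂ) :
    (G.ext (X × B)).apply (((F.ext (X × C)).apply
        (ρ.submatrix (prodRightComm X C A) (prodRightComm X C A))).submatrix
          (prodRightComm X B C) (prodRightComm X B C)) =
      ((F.ext (X × D)).apply (((G.ext (X × A)).apply ρ).submatrix
        (prodRightComm X D A) (prodRightComm X D A))).submatrix
          (prodRightComm X B D) (prodRightComm X B D) := by
  ext ⟨⟨x, b⟩, d⟩ ⟨⟨x', b'⟩, d'⟩
  rw [Matrix.submatrix_apply, ext_apply_eq_sum_coeff, ext_apply_eq_sum_coeff]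
  simp only [Matrix.submatrix_apply, ext_apply_eq_sum_coeff, Finset.mul_sum]
  rw [Finset.sum_comm]
  refine Finset.sum_congr rfl fun q _ => Finset.sum_congr rfl fun r _ => ?_
  exact mul_left_comm _ _ _

/-- Splitting off the first tensor factor. -/
def prodConsEquiv (X A : Type) (n : ℕ) : (X × A) × (Fin n → A) ≃ X × (Fin (n + 1) → A) :=
  (Equiv.prodAssoc X A (Fin n → A)).trans
    ((Equiv.refl X).prodCongr (Fin.consEquiv fun _ : Fin (n + 1) => A))

theorem pow_succ_ext_apply (F : KrausFamily A B) (n : ℕ)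
    (ρ : Matrix (X × (Fin (n + 1) → A)) (X × (Fin (n + 1) → A)) ℂ) :
    (((F.pow (n + 1)).ext X).apply ρ).submatrix (prodConsEquiv X B n) (prodConsEquiv X B n) =
      ((F.pow n).ext (X × B)).apply (((F.ext (X × (Fin n → A))).apply
        ((ρ.submatrix (prodConsEquiv X A n) (prodConsEquiv X A n)).submatrix
          (prodRightComm X _ A) (prodRightComm X _ A))).submatrix
          (prodRightComm X B _) (prodRightComm X B _)) := by
  ext ⟨⟨x, b⟩, β⟩ ⟨⟨x', b'⟩, β'⟩
  rw [Matrix.submatrix_apply, ext_apply_eq_sum_coeff, ext_apply_eq_sum_coeff]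
  simp only [Matrix.submatrix_apply, ext_apply_eq_sum_coeff, Finset.mul_sum]
  rw [← Fintype.sum_prod_type']
  refine (Fintype.sum_equiv (((Equiv.prodComm _ _).trans (Equiv.prodProdProdComm A A _ _)).trans
    ((Fin.consEquiv fun _ : Fin (n + 1) => A).prodCongr
      (Fin.consEquiv fun _ : Fin (n + 1) => A))) _ _ fun q => ?_).symm
  obtain ⟨⟨α, α'⟩, a, a'⟩ := q
  rw [pow_coeff, pow_coeff, Fin.prod_univ_succ]
  exact (mul_left_comm _ _ _).trans (mul_assoc _ _ _).symm

theorem ExtendedEntropyGapLE.pow {F : KrausFamily A B} {G : KrausFamily A E} {y : ℝ}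
    (hF : F.IsChannel) (hG : G.IsChannel) (h : F.ExtendedEntropyGapLE G y) (n : ℕ) :
    (F.pow n).ExtendedEntropyGapLE (G.pow n) (n * y) := by
  induction n with
  | zero =>
    intro X _ _ ρ hρ
    have key : ∀ {B : Type} [Fintype B] [DecidableEq B] (F : KrausFamily A B),
        vnEntropy (((F.pow 0).ext X).apply ρ) = vnEntropy ρ := by
      intro B _ _ F
      rw [← vnEntropy_submatrix_equiv hρ.1.1
        ((Equiv.refl X).prodCongr (Equiv.ofUnique (Fin 0 → B) (Fin 0 → A)))]
      congr 1
      ext s s'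
      rw [ext_apply_eq_sum_coeff, Fintype.sum_prod_type, Fintype.sum_unique, Fintype.sum_unique,
        pow_coeff, Fin.prod_univ_zero, one_mul]
      rfl
    rw [key, key]
    simp
  | succ n ih =>
    intro X _ _ ρ hρ
    have hpos : ∀ {B : Type} [Fintype B] [DecidableEq B] (F : KrausFamily A B),
        (((F.pow (n + 1)).ext X).apply ρ).IsHermitian := fun F => (posSemidef_apply _ hρ.1).1
    rw [← vnEntropy_submatrix_equiv (hpos F) (prodConsEquiv X B n),
      ← vnEntropy_submatrix_equiv (hpos G) (prodConsEquiv X E n), pow_succ_ext_apply,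
      pow_succ_ext_apply]
    have hρ' := hρ.submatrix_equiv (prodConsEquiv X A n)
    have h1 := ih (X × B) _ (((F.ext (X × (Fin n → A))).isDensity_apply (isChannel_ext hF)
      (hρ'.submatrix_equiv (prodRightComm X _ A))).submatrix_equiv
        (prodRightComm X B _))
    have hσ := ((G.pow n).ext (X × A)).isDensity_apply (isChannel_ext (isChannel_pow hG n)) hρ'
    have h2 := h (X × (Fin n → E)) _ (hσ.submatrix_equiv (prodRightComm X _ A))
    rw [ext_apply_rightComm F (G.pow n), vnEntropy_submatrix_equiv
      (posSemidef_apply _ (hσ.submatrix_equiv (prodRightComm X _ A)).1).1] at h1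
    rw [ext_apply_rightComm G (G.pow n), vnEntropy_submatrix_equiv
      (posSemidef_apply _ (hσ.submatrix_equiv (prodRightComm X _ A)).1).1]
    push_cast
    linarith

theorem ExtendedEntropyGapLE.cohInfo_pow_le {M : KrausFamily A B} (hM : M.IsChannel) {y : ℝ}
    (h : M.ExtendedEntropyGapLE M.complFam y) (n : ℕ) {φ : Matrix (Fin n → A) (Fin n → A) ℂ}
    (hφ : IsDensity φ) : cohInfo (M.pow n) φ ≤ n * y := by
  have h1 := h.pow hM (isChannel_complFam hM) n Unit _
    (hφ.submatrix_equiv (Equiv.punitProd (Fin n → A)))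
  have key : ∀ {B : Type} [Fintype B] [DecidableEq B] (F : KrausFamily (Fin n → A) B),
      vnEntropy ((F.ext Unit).apply
        (φ.submatrix (Equiv.punitProd (Fin n → A)) (Equiv.punitProd (Fin n → A)))) =
        vnEntropy (F.apply φ) := by
    intro B _ _ F
    rw [← vnEntropy_submatrix_equiv (F.posSemidef_apply hφ.1).1 (Equiv.punitProd B)]
    congr 1
    ext ⟨⟨⟩, b⟩ ⟨⟨⟩, b'⟩
    rw [ext_apply_apply]
    rfl
  rw [key, key] at h1
  rw [cohInfo, ← complFam_apply]
  exact h1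

end KrausFamily

namespace KrausFamily

variable {C D X : Type} [Fintype C] [DecidableEq C] [Fintype D] [DecidableEq D]
  [Fintype X] [DecidableEq X]

/-- The flagged mixture of two channels with weights `c` and `d`. -/
noncomputable def mix (c d : ℝ) (M : KrausFamily A B) (N : KrausFamily A C) :
    KrausFamily A (B ⊕ C) where
  ι := M.ι ⊕ N.ι
  K s := Matrix.of fun t a =>
    Sum.elim (fun i => Sum.elim (fun b => (Real.sqrt c : ℂ) * M.K i b a) (fun _ => 0) t)
      (fun j => Sum.elim (fun _ => 0) (fun b => (Real.sqrt d : ℂ) * N.K j b a) t) s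

theorem complFam_mix (c d : ℝ) (M : KrausFamily A B) (N : KrausFamily A C) :
    (mix c d M N).complFam = mix c d M.complFam N.complFam := by
  have h : (mix c d M N).complFam.K = (mix c d M.complFam N.complFam).K := by
    funext s
    ext t a
    rcases s with s | s <;> rcases t with t | t <;> rfl
  exact congrArg (fun K => (⟨B ⊕ C, K⟩ : KrausFamily A (M.ι ⊕ N.ι))) h

theorem mix_apply {c d : ℝ} (hc : 0 ≤ c) (hd : 0 ≤ d) (M : KrausFamily A B) (N : KrausFamily A C)
    (ρ : Matrix A A ℂ) :
    (mix c d M N).apply ρ =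
      Matrix.fromBlocks ((c : ℂ) • M.apply ρ) 0 0 ((d : ℂ) • N.apply ρ) := by
  have hc' : (Real.sqrt c : ℂ) * Real.sqrt c = c := by
    rw [← Complex.ofReal_mul, Real.mul_self_sqrt hc]
  have hd' : (Real.sqrt d : ℂ) * Real.sqrt d = d := by
    rw [← Complex.ofReal_mul, Real.mul_self_sqrt hd]
  ext s t
  rw [apply_apply]
  refine (Fintype.sum_sum_type _).trans ?_
  rcases s with s | s <;> rcases t with t | t
  · simp only [mix, Matrix.of_apply, Sum.elim_inl, Sum.elim_inr, Matrix.fromBlocks_apply₁₁,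
      Matrix.smul_apply, apply_apply, smul_eq_mul, Finset.mul_sum, zero_mul,
      Finset.sum_const_zero, add_zero, ← hc', star_mul', Complex.star_def, Complex.conj_ofReal]
    refine Finset.sum_congr rfl fun i _ => Finset.sum_congr rfl fun a _ =>
      Finset.sum_congr rfl fun a' _ => ?_
    ring
  · simp [mix]
  · simp [mix]
  · simp only [mix, Matrix.of_apply, Sum.elim_inl, Sum.elim_inr, Matrix.fromBlocks_apply₂₂,
      Matrix.smul_apply, apply_apply, smul_eq_mul, Finset.mul_sum, zero_mul,
      Finset.sum_const_zero, zero_add, ← hd', star_mul', Complex.star_def, Complex.conj_ofReal]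
    refine Finset.sum_congr rfl fun i _ => Finset.sum_congr rfl fun a _ =>
      Finset.sum_congr rfl fun a' _ => ?_
    ring

theorem isChannel_mix {c d : ℝ} (hc : 0 ≤ c) (hd : 0 ≤ d) (hcd : c + d = 1)
    {M : KrausFamily A B} {N : KrausFamily A C} (hM : M.IsChannel) (hN : N.IsChannel) :
    (mix c d M N).IsChannel := by
  have hc' : (Real.sqrt c : ℂ) * Real.sqrt c = c := by
    rw [← Complex.ofReal_mul, Real.mul_self_sqrt hc]
  have hd' : (Real.sqrt d : ℂ) * Real.sqrt d = d := by
    rw [← Complex.ofReal_mul, Real.mul_self_sqrt hd]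
  have hcd' : (c : ℂ) + d = 1 := by exact_mod_cast hcd
  rw [isChannel_iff] at hM hN ⊢
  intro a a'
  have h : (if a = a' then 1 else 0 : ℂ) =
      c * (if a = a' then 1 else 0) + d * (if a = a' then 1 else 0) := by
    rw [← add_mul, hcd', one_mul]
  rw [h, Fintype.sum_prod_type]
  refine (Fintype.sum_sum_type _).trans (congrArg₂ _ ?_ ?_)
  · rw [← hM, Fintype.sum_prod_type]
    simp only [mix, Matrix.of_apply, Sum.elim_inl, Fintype.sum_sum_type,
      Sum.elim_inr, mul_zero, Finset.sum_const_zero, add_zero, Finset.mul_sum, ← hc', map_mul,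
      Complex.star_def, Complex.conj_ofReal]
    refine Finset.sum_congr rfl fun i _ => Finset.sum_congr rfl fun b _ => ?_
    ring
  · rw [← hN, Fintype.sum_prod_type]
    simp only [mix, Matrix.of_apply, Sum.elim_inl, Fintype.sum_sum_type,
      Sum.elim_inr, mul_zero, Finset.sum_const_zero, zero_add, Finset.mul_sum, ← hd', map_mul,
      Complex.star_def, Complex.conj_ofReal]
    refine Finset.sum_congr rfl fun i _ => Finset.sum_congr rfl fun b _ => ?_
    ring

theorem _root_.vnEntropy_fromBlocks_smul {m n : Type} [Fintype m] [DecidableEq m] [Fintype n]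
    [DecidableEq n] {c d : ℝ} (hc : 0 ≤ c) (hd : 0 ≤ d) {ρ : Matrix m m ℂ} {σ : Matrix n n ℂ}
    (hρ : IsDensity ρ) (hσ : IsDensity σ) :
    vnEntropy (Matrix.fromBlocks ((c : ℂ) • ρ) 0 0 ((d : ℂ) • σ)) =
      c * vnEntropy ρ + d * vnEntropy σ - (c * Real.logb 2 c + d * Real.logb 2 d) := by
  rw [vnEntropy_fromBlocks, vnEntropy_smul hρ.1.1 hc, vnEntropy_smul hσ.1.1 hd, hρ.2, hσ.2]
  · simp
    ring
  · exact (hρ.1.smul (by exact_mod_cast hc : (0 : ℂ) ≤ c)).1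
  · exact (hσ.1.smul (by exact_mod_cast hd : (0 : ℂ) ≤ d)).1

theorem vnEntropy_mix_ext_apply {c d : ℝ} (hc : 0 ≤ c) (hd : 0 ≤ d) {M : KrausFamily A B}
    {N : KrausFamily A C} (hM : M.IsChannel) (hN : N.IsChannel)
    {ρ : Matrix (X × A) (X × A) ℂ} (hρ : IsDensity ρ) :
    vnEntropy (((mix c d M N).ext X).apply ρ) =
      c * vnEntropy ((M.ext X).apply ρ) + d * vnEntropy ((N.ext X).apply ρ) -
        (c * Real.logb 2 c + d * Real.logb 2 d) := by
  rw [← vnEntropy_fromBlocks_smul hc hd ((M.ext X).isDensity_apply (isChannel_ext hM) hρ)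
    ((N.ext X).isDensity_apply (isChannel_ext hN) hρ),
    ← vnEntropy_submatrix_equiv (posSemidef_apply _ hρ.1).1 (Equiv.prodSumDistrib X B C).symm]
  congr 1
  ext s t
  rcases s with ⟨x, s⟩ | ⟨x, s⟩ <;> rcases t with ⟨y, t⟩ | ⟨y, t⟩ <;>
    simp [ext_apply_apply, mix_apply hc hd]

/-- The channel acting as `S` or `T` according to the flag. -/
def sumElim (S : KrausFamily B D) (T : KrausFamily C D) : KrausFamily (B ⊕ C) D where
  ι := S.ι ⊕ T.ι
  K s := Sum.elim (fun i => Matrix.fromCols (S.K i) 0) (fun j => Matrix.fromCols 0 (T.K j)) s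

theorem sumElim_apply (S : KrausFamily B D) (T : KrausFamily C D) (ρ : Matrix B B ℂ)
    (σ : Matrix C C ℂ) :
    (sumElim S T).apply (Matrix.fromBlocks ρ 0 0 σ) = S.apply ρ + T.apply σ := by
  refine (Fintype.sum_sum_type _).trans (congrArg₂ _ ?_ ?_) <;>
    refine Finset.sum_congr rfl fun i _ => ?_ <;>
    simp [sumElim, Matrix.conjTranspose_fromCols_eq_fromRows_conjTranspose,
      Matrix.fromCols_mul_fromBlocks, Matrix.fromCols_mul_fromRows]

theorem isChannel_sumElim {S : KrausFamily B D} {T : KrausFamily C D} (hS : S.IsChannel)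
    (hT : T.IsChannel) : (sumElim S T).IsChannel := by
  refine (Fintype.sum_sum_type _).trans ?_
  have h1 : ∀ i, ((sumElim S T).K (Sum.inl i))ᴴ * (sumElim S T).K (Sum.inl i) =
      Matrix.fromBlocks ((S.K i)ᴴ * S.K i) 0 0 0 := by
    intro i
    simp only [sumElim, Sum.elim_inl,
      Matrix.conjTranspose_fromCols_eq_fromRows_conjTranspose, Matrix.fromRows_mul_fromCols]
    simp
  have h2 : ∀ i, ((sumElim S T).K (Sum.inr i))ᴴ * (sumElim S T).K (Sum.inr i) =
      Matrix.fromBlocks 0 0 0 ((T.K i)ᴴ * T.K i) := by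
    intro i
    simp only [sumElim, Sum.elim_inr,
      Matrix.conjTranspose_fromCols_eq_fromRows_conjTranspose, Matrix.fromRows_mul_fromCols]
    simp
  rw [Finset.sum_congr rfl fun i _ => h1 i, Finset.sum_congr rfl fun i _ => h2 i]
  have h3 : ∑ i, Matrix.fromBlocks ((S.K i)ᴴ * S.K i) 0 0 (0 : Matrix C C ℂ) =
      Matrix.fromBlocks 1 0 0 0 := by
    rw [← (show ∑ i, (S.K i)ᴴ * S.K i = 1 from hS)]
    ext (s | s) (t | t) <;> simp [Matrix.sum_apply]
  have h4 : ∑ i, Matrix.fromBlocks (0 : Matrix B B ℂ) 0 0 ((T.K i)ᴴ * T.K i) =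
      Matrix.fromBlocks 0 0 0 1 := by
    rw [← (show ∑ i, (T.K i)ᴴ * T.K i = 1 from hT)]
    ext (s | s) (t | t) <;> simp [Matrix.sum_apply]
  rw [h3, h4, Matrix.fromBlocks_add]
  simp

end KrausFamily

namespace KrausFamily

variable {C D : Type} [Fintype C] [DecidableEq C] [Fintype D] [DecidableEq D]

/-- The difference of the output entropies of a channel and its complement on an extended input. -/
noncomputable def entropyGap (M : KrausFamily A B) (X : Type) [Fintype X] [DecidableEq X]
    (ρ : Matrix (X × A) (X × A) ℂ) : ℝ :=
  vnEntropy ((M.ext X).apply ρ) - vnEntropy ((M.complFam.ext X).apply ρ)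

theorem entropyGap_mix {X : Type} [Fintype X] [DecidableEq X] {c d : ℝ} (hc : 0 ≤ c) (hd : 0 ≤ d)
    {M : KrausFamily A B} {N : KrausFamily A C} (hM : M.IsChannel) (hN : N.IsChannel)
    {ρ : Matrix (X × A) (X × A) ℂ} (hρ : IsDensity ρ) :
    (mix c d M N).entropyGap X ρ = c * M.entropyGap X ρ + d * N.entropyGap X ρ := by
  have h1 := vnEntropy_mix_ext_apply hc hd hM hN hρ
  have h2 := vnEntropy_mix_ext_apply hc hd (isChannel_complFam hM) (isChannel_complFam hN) hρ
  have h3 : vnEntropy (((mix c d M N).complFam.ext X).apply ρ) =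
      vnEntropy (((mix c d M.complFam N.complFam).ext X).apply ρ) := by
    rw [← complFam_mix]
    rfl
  rw [entropyGap, h3, h1, h2, entropyGap, entropyGap]
  ring

theorem entropyGap_le_cohInfo_marginal {X : Type} [Fintype X] [DecidableEq X]
    {M : KrausFamily A B} (hM : M.IsDegradable) {ρ : Matrix (X × A) (X × A) ℂ}
    (hρ : IsDensity ρ) : M.entropyGap X ρ ≤ cohInfo M (marginal ρ) := by
  obtain ⟨D, hD, h⟩ := hM
  have h' : ∀ ρ, D.apply (M.apply ρ) = M.complFam.apply ρ := fun ρ =>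
    (h ρ).trans (M.complFam_apply ρ).symm
  have hm := vnEntropy_marginal_sub_le hD ((M.ext X).posSemidef_apply hρ.1)
  rw [marginal_ext_apply, ext_apply_comp h', h] at hm
  rw [entropyGap, cohInfo]
  linarith

theorem _root_.IsDensity.convexComb {n : Type} [Fintype n] {c d : ℝ} (hc : 0 ≤ c) (hd : 0 ≤ d)
    (hcd : c + d = 1) {ρ σ : Matrix n n ℂ} (hρ : IsDensity ρ) (hσ : IsDensity σ) :
    IsDensity ((c : ℂ) • ρ + (d : ℂ) • σ) := by
  refine ⟨(hρ.1.smul (by exact_mod_cast hc : (0 : ℂ) ≤ c)).add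
    (hσ.1.smul (by exact_mod_cast hd : (0 : ℂ) ≤ d)), ?_⟩
  rw [Matrix.trace_add, Matrix.trace_smul, Matrix.trace_smul, hρ.2, hσ.2]
  simp only [smul_eq_mul, mul_one]
  exact_mod_cast hcd

theorem _root_.IsDensity.fromBlocks {m n : Type} [Fintype m] [DecidableEq m] [Fintype n]
    [DecidableEq n] {c d : ℝ} (hc : 0 ≤ c)
    (hd : 0 ≤ d) (hcd : c + d = 1) {ρ : Matrix m m ℂ} {σ : Matrix n n ℂ} (hρ : IsDensity ρ)
    (hσ : IsDensity σ) : IsDensity (Matrix.fromBlocks ((c : ℂ) • ρ) 0 0 ((d : ℂ) • σ)) := by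
  refine ⟨?_, ?_⟩
  · have h := ((hρ.1.smul (by exact_mod_cast hc : (0 : ℂ) ≤ c)).mul_mul_conjTranspose_same
      (Matrix.fromRows 1 (0 : Matrix n m ℂ))).add
        ((hσ.1.smul (by exact_mod_cast hd : (0 : ℂ) ≤ d)).mul_mul_conjTranspose_same
          (Matrix.fromRows (0 : Matrix m n ℂ) 1))
    convert h using 1
    simp only [Matrix.conjTranspose_fromRows_eq_fromCols_conjTranspose, Matrix.fromRows_mul,
      Matrix.mul_fromCols]
    ext (s | s) (t | t) <;> simp
  · have h : ((c : ℂ) • ρ).trace + ((d : ℂ) • σ).trace = 1 := by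
      rw [Matrix.trace_smul, Matrix.trace_smul, hρ.2, hσ.2]
      simp only [smul_eq_mul, mul_one]
      exact_mod_cast hcd
    exact (Fintype.sum_sum_type _).trans h

/-- The coherent information of a degradable channel is concave. -/
theorem cohInfo_concave {M : KrausFamily A B} (hM : M.IsChannel) (hdeg : M.IsDegradable)
    {c d : ℝ} (hc : 0 ≤ c) (hd : 0 ≤ d) (hcd : c + d = 1) {ρ σ : Matrix A A ℂ}
    (hρ : IsDensity ρ) (hσ : IsDensity σ) :
    c * cohInfo M ρ + d * cohInfo M σ ≤ cohInfo M ((c : ℂ) • ρ + (d : ℂ) • σ) := by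
  set τ : Matrix (Bool × A) (Bool × A) ℂ :=
    (Matrix.fromBlocks ((c : ℂ) • ρ) 0 0 ((d : ℂ) • σ)).submatrix
      (Equiv.boolProdEquivSum A) (Equiv.boolProdEquivSum A) with hτ
  have hden : IsDensity τ := (IsDensity.fromBlocks hc hd hcd hρ hσ).submatrix_equiv _
  have hmarg : marginal τ = (c : ℂ) • ρ + (d : ℂ) • σ := by
    ext a a'
    simp [marginal, hτ, add_comm]
  have key : ∀ {F : Type} [Fintype F] [DecidableEq F] {R : KrausFamily A F}, R.IsChannel →
      vnEntropy ((R.ext Bool).apply τ) = c * vnEntropy (R.apply ρ) + d * vnEntropy (R.apply σ) -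
        (c * Real.logb 2 c + d * Real.logb 2 d) := by
    intro F _ _ R hR
    rw [← vnEntropy_fromBlocks_smul hc hd (R.isDensity_apply hR hρ) (R.isDensity_apply hR hσ),
      ← vnEntropy_submatrix_equiv (IsDensity.fromBlocks hc hd hcd (R.isDensity_apply hR hρ)
        (R.isDensity_apply hR hσ)).1.1 (Equiv.boolProdEquivSum F)]
    congr 1
    have h1 : ∀ x x', τ.submatrix (Prod.mk x) (Prod.mk x') =
        if x = x' then (if x = false then (c : ℂ) • ρ else (d : ℂ) • σ) else 0 := by
      rintro (_ | _) (_ | _) <;> ext a a' <;> simp [hτ]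
    have h0 : R.apply 0 = 0 := by simp [apply]
    ext ⟨x, b⟩ ⟨x', b'⟩
    rw [ext_apply_apply, h1]
    rcases x with _ | _ <;> rcases x' with _ | _ <;> simp [apply_smul, h0, -Complex.coe_smul]
  have h := entropyGap_le_cohInfo_marginal hdeg hden
  rw [hmarg, entropyGap, key hM, key (isChannel_complFam hM), complFam_apply, complFam_apply] at h
  rw [cohInfo, cohInfo]
  linarith

/-- The map `L` is a post-processing of a channel whose entropy gap is bounded, on every extended
input, by the value of `f` at the reduced input state. -/
def HasGapBound (L : Matrix A A ℂ → Matrix D D ℂ) (f : Matrix A A ℂ → ℝ) : Prop :=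
  ∃ (B : Type) (_ : Fintype B) (_ : DecidableEq B) (M : KrausFamily A B) (T : KrausFamily B D),
    M.IsChannel ∧ T.IsChannel ∧ (∀ ρ, T.apply (M.apply ρ) = L ρ) ∧
    ∀ (X : Type) [Fintype X] [DecidableEq X] (ρ : Matrix (X × A) (X × A) ℂ), IsDensity ρ →
      M.entropyGap X ρ ≤ f (marginal ρ)

theorem HasGapBound.mono {L L' : Matrix A A ℂ → Matrix D D ℂ} {f f' : Matrix A A ℂ → ℝ}
    (h : HasGapBound L f) (hL : ∀ ρ, L ρ = L' ρ) (hf : ∀ φ, IsDensity φ → f φ ≤ f' φ) :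
    HasGapBound L' f' := by
  obtain ⟨B, _, _, M, T, hM, hT, hTM, hgap⟩ := h
  exact ⟨B, _, _, M, T, hM, hT, fun ρ => (hTM ρ).trans (hL ρ), fun X _ _ ρ hρ =>
    (hgap X ρ hρ).trans (hf _ (isDensity_marginal hρ))⟩

theorem HasGapBound.convexComb {L L' : Matrix A A ℂ → Matrix D D ℂ} {f f' : Matrix A A ℂ → ℝ}
    (h : HasGapBound L f) (h' : HasGapBound L' f') {c d : ℝ} (hc : 0 ≤ c) (hd : 0 ≤ d)
    (hcd : c + d = 1) :
    HasGapBound (fun ρ => (c : ℂ) • L ρ + (d : ℂ) • L' ρ) (fun φ => c * f φ + d * f' φ) := by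
  obtain ⟨B, _, _, M, T, hM, hT, hTM, hgap⟩ := h
  obtain ⟨B', _, _, M', T', hM', hT', hTM', hgap'⟩ := h'
  refine ⟨B ⊕ B', inferInstance, inferInstance, mix c d M M', sumElim T T',
    isChannel_mix hc hd hcd hM hM', isChannel_sumElim hT hT', fun ρ => ?_, fun X _ _ ρ hρ => ?_⟩
  · rw [mix_apply hc hd, sumElim_apply, apply_smul, apply_smul, hTM, hTM']
  · rw [entropyGap_mix hc hd hM hM' hρ]
    exact add_le_add (mul_le_mul_of_nonneg_left (hgap X ρ hρ) hc)
      (mul_le_mul_of_nonneg_left (hgap' X ρ hρ) hd)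

/-- Conjugating input and output by a unitary. -/
theorem HasGapBound.conj {L : Matrix A A ℂ → Matrix A A ℂ} {f : Matrix A A ℂ → ℝ}
    (h : HasGapBound L f) {U : Matrix A A ℂ} (hU : Uᴴ * U = 1) (hU' : U * Uᴴ = 1) :
    HasGapBound (fun ρ => Uᴴ * L (U * ρ * Uᴴ) * U) (fun φ => f (U * φ * Uᴴ)) := by
  obtain ⟨B, _, _, M, T, hM, hT, hTM, hgap⟩ := h
  set M' : KrausFamily A B := ⟨M.ι, fun i => M.K i * U⟩
  set T' : KrausFamily B A := ⟨T.ι, fun i => Uᴴ * T.K i⟩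
  have happ : ∀ ρ, M.apply ((single U).apply ρ) = M'.apply ρ := by
    intro ρ
    rw [single_apply]
    refine Finset.sum_congr rfl fun i _ => ?_
    change _ = M.K i * U * ρ * (M.K i * U)ᴴ
    simp [Matrix.mul_assoc]
  have happ' : ∀ ρ, M.complFam.apply ((single U).apply ρ) = M'.complFam.apply ρ := by
    intro ρ
    rw [single_apply, complFam_apply]
    refine Eq.trans ?_ (complFam_apply M' ρ).symm
    ext i j
    change _ = (M.K i * U * ρ * (M.K j * U)ᴴ).trace
    simp [compl, Matrix.mul_assoc]
  refine ⟨B, _, _, M', T', ?_, ?_, fun ρ => ?_, fun X _ _ ρ hρ => ?_⟩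
  · have h1 : ∑ i, (M.K i * U)ᴴ * (M.K i * U) = Uᴴ * (∑ i, (M.K i)ᴴ * M.K i) * U := by
      simp [Finset.mul_sum, Finset.sum_mul, Matrix.mul_assoc]
    rw [show ∑ i, (M.K i)ᴴ * M.K i = 1 from hM, Matrix.mul_one, hU] at h1
    exact h1
  · have h1 : ∀ i, (Uᴴ * T.K i)ᴴ * (Uᴴ * T.K i) = (T.K i)ᴴ * T.K i := by
      intro i
      rw [Matrix.conjTranspose_mul, Matrix.conjTranspose_conjTranspose, Matrix.mul_assoc,
        ← Matrix.mul_assoc U, hU', Matrix.one_mul]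
    exact (Finset.sum_congr rfl fun i _ => h1 i).trans hT
  · beta_reduce
    rw [← happ, single_apply, ← hTM]
    change ∑ i, Uᴴ * T.K i * M.apply (U * ρ * Uᴴ) * (Uᴴ * T.K i)ᴴ =
      Uᴴ * (∑ i, T.K i * M.apply (U * ρ * Uᴴ) * (T.K i)ᴴ) * U
    simp [Matrix.mul_sum, Matrix.sum_mul, Matrix.mul_assoc]
  · have h1 := hgap X _ (((single U).ext X).isDensity_apply
      (isChannel_ext (single_isChannel hU)) hρ)
    rw [marginal_ext_apply, single_apply, entropyGap, ext_apply_comp happ] at h1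
    refine le_trans (le_of_eq ?_) h1
    rw [entropyGap, ext_apply_comp happ']

theorem HasGapBound.of_isDegradable {M : KrausFamily A A} (hM : M.IsChannel)
    (h : M.IsDegradable) : HasGapBound M.apply (cohInfo M) :=
  ⟨A, _, _, M, single 1, hM, single_isChannel (by simp), fun ρ => by simp,
    fun _ _ _ _ hρ => entropyGap_le_cohInfo_marginal h hρ⟩

theorem HasGapBound.of_isAntidegradable {M : KrausFamily A A} (hM : M.IsChannel)
    (h : M.IsAntidegradable) : HasGapBound M.apply (fun _ => 0) := by
  obtain ⟨D, hD, hDM⟩ := h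
  have h2 : (0 : ℝ) ≤ 1 / 2 := by norm_num
  refine ⟨A ⊕ M.ι, inferInstance, inferInstance, mix (1 / 2) (1 / 2) M M.complFam,
    sumElim (single 1) D, isChannel_mix h2 h2 (by norm_num) hM (isChannel_complFam hM),
    isChannel_sumElim (single_isChannel (by simp)) hD, fun ρ => ?_, fun X _ _ ρ hρ => ?_⟩
  · rw [mix_apply h2 h2, sumElim_apply, apply_smul, apply_smul, complFam_apply, hDM, single_apply,
      Matrix.conjTranspose_one, Matrix.mul_one, Matrix.one_mul, ← add_smul]
    norm_num
  · rw [entropyGap_mix h2 h2 hM (isChannel_complFam hM) hρ, entropyGap, entropyGap]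
    rw [show vnEntropy ((M.complFam.complFam.ext X).apply ρ) = vnEntropy ((M.ext X).apply ρ)
      from rfl]
    linarith

theorem HasGapBound.cohInfo_pow_le {N : KrausFamily A D} {y : ℝ}
    (h : HasGapBound N.apply (fun _ => y)) (n : ℕ) {φ : Matrix (Fin n → A) (Fin n → A) ℂ}
    (hφ : IsDensity φ) : cohInfo (N.pow n) φ ≤ n * y := by
  obtain ⟨B, _, _, M, T, hM, hT, hTM, hgap⟩ := h
  exact (cohInfo_le_of_apply_comp (isChannel_pow hT n) (pow_apply_comp hTM n) hφ.1).trans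
    (ExtendedEntropyGapLE.cohInfo_pow_le hM hgap n hφ)

/-- The coherent information vanishes on pure basis states. -/
theorem cohInfo_single (N : KrausFamily A B) (a : A) : cohInfo N (Matrix.single a a 1) = 0 := by
  set W : Matrix B N.ι ℂ := Matrix.of fun b i => N.K i b a with hW
  have h1 : N.apply (Matrix.single a a 1) = W * Wᴴ := by
    ext b b'
    rw [apply_single_eq_coeff]
    rfl
  have h2 : N.compl (Matrix.single a a 1) = (Wᴴ * W)ᵀ := by
    ext i j
    rw [← complFam_apply, apply_single_eq_coeff, Matrix.transpose_apply, Matrix.mul_apply]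
    exact Finset.sum_congr rfl fun b _ => mul_comm _ _
  rw [cohInfo, h1, h2, vnEntropy_transpose (Matrix.isHermitian_conjTranspose_mul_self W),
    vnEntropy_mul_conjTranspose, sub_self]

theorem isDensity_single (a : A) : IsDensity (Matrix.single a a (1 : ℂ)) := by
  refine ⟨?_, by simp⟩
  have h := Matrix.posSemidef_vecMulVec_self_star (Pi.single a (1 : ℂ))
  rwa [← Pi.single_star, star_one, ← Matrix.single_eq_single_vecMulVec_single] at h

theorem HasGapBound.nonneg [Nonempty A] {N : KrausFamily A D} {y : ℝ}
    (h : HasGapBound N.apply (fun _ => y)) : 0 ≤ y := by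
  have h1 := h.cohInfo_pow_le 1 (isDensity_single (Classical.arbitrary (Fin 1 → A)))
  rw [cohInfo_single] at h1
  simpa using h1

theorem HasGapBound.Qcap_le [Nonempty A] {N : KrausFamily A D} {y : ℝ}
    (h : HasGapBound N.apply (fun _ => y)) : Qcap N ≤ y := by
  have hy := h.nonneg
  refine Real.sSup_le ?_ hy
  rintro x ⟨n, hn, rfl⟩
  have hn' : (0 : ℝ) < n := by exact_mod_cast hn
  have : Q1 (N.pow n) ≤ n * y := by
    refine Real.sSup_le ?_ (by positivity)
    rintro x ⟨φ, hφ, rfl⟩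
    exact h.cohInfo_pow_le n hφ
  rw [one_div, inv_mul_le_iff₀ hn']
  exact this

end KrausFamily

/-- The qubit channel acting on Bloch vectors by `(x, y, z) ↦ (a x, b y, c z)`. -/
noncomputable def blochMap (a b c : ℝ) (ρ : Matrix (Fin 2) (Fin 2) ℂ) : Matrix (Fin 2) (Fin 2) ℂ :=
  !![(1 + c) / 2 * ρ 0 0 + (1 - c) / 2 * ρ 1 1, (a + b) / 2 * ρ 0 1 + (a - b) / 2 * ρ 1 0;
    (a - b) / 2 * ρ 0 1 + (a + b) / 2 * ρ 1 0, (1 - c) / 2 * ρ 0 0 + (1 + c) / 2 * ρ 1 1]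

theorem blochMap_convexComb {c d : ℝ} (h : c + d = 1) (x y z x' y' z' : ℝ)
    (ρ : Matrix (Fin 2) (Fin 2) ℂ) :
    (c : ℂ) • blochMap x y z ρ + (d : ℂ) • blochMap x' y' z' ρ =
      blochMap (c * x + d * x') (c * y + d * y') (c * z + d * z') ρ := by
  have h : (c : ℂ) + d = 1 := by exact_mod_cast h
  ext i j
  fin_cases i <;> fin_cases j <;> simp [blochMap] <;> grind

theorem depol_isChannel {p : ℝ} (hp0 : 0 ≤ p) (hp1 : p ≤ 1) : (depol p).IsChannel := by
  have h1 : ((√(1 - p) : ℝ) : ℂ) ^ 2 = 1 - p := by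
    rw [← Complex.ofReal_pow, Real.sq_sqrt (by linarith)]; push_cast; rfl
  have h2 : ((√(p / 3) : ℝ) : ℂ) ^ 2 = p / 3 := by
    rw [← Complex.ofReal_pow, Real.sq_sqrt (by linarith)]; push_cast; rfl
  change ∑ i : Fin 4, ((depol p).K i)ᴴ * (depol p).K i = 1
  simp only [depol]
  generalize √(1 - p) = s at h1
  generalize √(p / 3) = t at h2
  ext i j
  fin_cases i <;> fin_cases j <;>
    simp [Fin.sum_univ_four, PauliX, PauliY, PauliZ, Matrix.mul_apply] <;> ring_nf <;>
    simp [h1, h2] <;> ring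

theorem depol_apply {p : ℝ} (hp0 : 0 ≤ p) (hp1 : p ≤ 1) (ρ : Matrix (Fin 2) (Fin 2) ℂ) :
    (depol p).apply ρ = blochMap (1 - 4 * p / 3) (1 - 4 * p / 3) (1 - 4 * p / 3) ρ := by
  have h1 : ((√(1 - p) : ℝ) : ℂ) ^ 2 = 1 - p := by
    rw [← Complex.ofReal_pow, Real.sq_sqrt (by linarith)]; push_cast; rfl
  have h2 : ((√(p / 3) : ℝ) : ℂ) ^ 2 = p / 3 := by
    rw [← Complex.ofReal_pow, Real.sq_sqrt (by linarith)]; push_cast; rfl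
  change ∑ i : Fin 4, (depol p).K i * ρ * ((depol p).K i)ᴴ = _
  simp only [depol]
  generalize √(1 - p) = s at h1
  generalize √(p / 3) = t at h2
  ext i j
  fin_cases i <;> fin_cases j <;>
    simp [blochMap, Fin.sum_univ_four, PauliX, PauliY, PauliZ, Matrix.mul_apply,
      Matrix.vecMul, Matrix.vecHead, Matrix.vecTail] <;> ring_nf <;>
    simp [h1, h2] <;> ring

namespace KrausFamily

/-- The two-Kraus-operator qubit channel with angles `u` and `v`. -/
noncomputable def qubit (u v : ℝ) : KrausFamily (Fin 2) (Fin 2) where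
  ι := Fin 2
  K := ![!![(Real.cos ((v - u) / 2) : ℂ), 0; 0, (Real.cos ((v + u) / 2) : ℂ)],
    !![0, (Real.sin ((v + u) / 2) : ℂ); (Real.sin ((v - u) / 2) : ℂ), 0]]

theorem qubit_isChannel (u v : ℝ) : (qubit u v).IsChannel := by
  have h1 : ((Real.cos ((v - u) / 2) : ℝ) : ℂ) ^ 2 + ((Real.sin ((v - u) / 2) : ℝ) : ℂ) ^ 2 = 1 := by
    exact_mod_cast Real.cos_sq_add_sin_sq _
  have h2 : ((Real.cos ((v + u) / 2) : ℝ) : ℂ) ^ 2 + ((Real.sin ((v + u) / 2) : ℝ) : ℂ) ^ 2 = 1 := by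
    exact_mod_cast Real.cos_sq_add_sin_sq _
  change ∑ i : Fin 2, ((qubit u v).K i)ᴴ * (qubit u v).K i = 1
  ext i j
  fin_cases i <;> fin_cases j <;>
    simp [-Complex.ofReal_cos, -Complex.ofReal_sin, qubit, Fin.sum_univ_two, Matrix.mul_apply] <;>
    grind

theorem half_angle_identities (u v : ℝ) :
    let c := Real.cos ((v - u) / 2)
    let d := Real.cos ((v + u) / 2)
    let s := Real.sin ((v - u) / 2)
    let t := Real.sin ((v + u) / 2)
    c ^ 2 = (1 + Real.cos u * Real.cos v + Real.sin u * Real.sin v) / 2 ∧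
    d ^ 2 = (1 + Real.cos u * Real.cos v - Real.sin u * Real.sin v) / 2 ∧
    s ^ 2 = (1 - Real.cos u * Real.cos v - Real.sin u * Real.sin v) / 2 ∧
    t ^ 2 = (1 - Real.cos u * Real.cos v + Real.sin u * Real.sin v) / 2 ∧
    c * d = (Real.cos u + Real.cos v) / 2 ∧ t * s = (Real.cos u - Real.cos v) / 2 ∧
    c * t = (Real.sin v + Real.sin u) / 2 ∧ d * s = (Real.sin v - Real.sin u) / 2 := by
  intro c d s t
  have hu : u = (v + u) / 2 - (v - u) / 2 := by ring
  have hv : v = (v + u) / 2 + (v - u) / 2 := by ring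
  have hcu : Real.cos u = d * c + t * s := by conv_lhs => rw [hu, Real.cos_sub]
  have hcv : Real.cos v = d * c - t * s := by conv_lhs => rw [hv, Real.cos_add]
  have hsu : Real.sin u = t * c - d * s := by conv_lhs => rw [hu, Real.sin_sub]
  have hsv : Real.sin v = t * c + d * s := by conv_lhs => rw [hv, Real.sin_add]
  have h1 : c ^ 2 + s ^ 2 = 1 := Real.cos_sq_add_sin_sq _
  have h2 : d ^ 2 + t ^ 2 = 1 := Real.cos_sq_add_sin_sq _
  rw [hcu, hcv, hsu, hsv]
  refine ⟨?_, ?_, ?_, ?_, ?_, ?_, ?_, ?_⟩ <;> grind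

theorem qubit_apply (u v : ℝ) (ρ : Matrix (Fin 2) (Fin 2) ℂ) :
    (qubit u v).apply ρ =
      blochMap (Real.cos u) (Real.cos v) (Real.cos u * Real.cos v) ρ +
        ((Real.sin u * Real.sin v / 2 : ℝ) * ρ.trace) • PauliZ := by
  obtain ⟨h1, h2, h3, h4, h5, h6, -, -⟩ := half_angle_identities u v
  apply_fun ((↑) : ℝ → ℂ) at h1 h2 h3 h4 h5 h6
  push_cast [-Complex.ofReal_cos, -Complex.ofReal_sin] at h1 h2 h3 h4 h5 h6
  change ∑ i : Fin 2, (qubit u v).K i * ρ * ((qubit u v).K i)ᴴ = _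
  ext i j
  fin_cases i <;> fin_cases j <;>
    simp [-Complex.ofReal_cos, -Complex.ofReal_sin, qubit, blochMap, Fin.sum_univ_two,
      Matrix.mul_apply, PauliZ, Matrix.trace, Matrix.vecMul, Matrix.vecHead, Matrix.vecTail] <;>
    grind

theorem qubit_compl (u v : ℝ) (ρ : Matrix (Fin 2) (Fin 2) ℂ) :
    (qubit u v).compl ρ =
      blochMap (Real.sin v) (Real.sin u) (Real.sin u * Real.sin v) ρ +
        ((Real.cos u * Real.cos v / 2 : ℝ) * ρ.trace) • PauliZ := by
  obtain ⟨h1, h2, h3, h4, -, -, h5, h6⟩ := half_angle_identities u v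
  apply_fun ((↑) : ℝ → ℂ) at h1 h2 h3 h4 h5 h6
  push_cast [-Complex.ofReal_cos, -Complex.ofReal_sin] at h1 h2 h3 h4 h5 h6
  change Matrix.of (fun i j : Fin 2 => ((qubit u v).K i * ρ * ((qubit u v).K j)ᴴ).trace) = _
  ext i j
  fin_cases i <;> fin_cases j <;>
    simp [-Complex.ofReal_cos, -Complex.ofReal_sin, qubit, blochMap, Fin.sum_univ_two,
      Matrix.mul_apply, PauliZ, Matrix.trace] <;>
    grind

theorem qubit_isDegradable {u v : ℝ} (hu : 0 < Real.cos u) (hv : 0 < Real.cos v)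
    (h : |Real.sin v| ≤ |Real.cos u|) : (qubit u v).IsDegradable := by
  set a := Real.cos u
  set b := Real.cos v
  set s := Real.sin u
  set t := Real.sin v
  have has : a ^ 2 + s ^ 2 = 1 := Real.cos_sq_add_sin_sq _
  have hbt : b ^ 2 + t ^ 2 = 1 := Real.cos_sq_add_sin_sq _
  have hta : t ^ 2 ≤ a ^ 2 := sq_le_sq.mpr h
  have hsb : s ^ 2 ≤ b ^ 2 := by linarith
  have ht1 := abs_le.mp (abs_le_of_sq_le_sq hta hu.le)
  have hs1 := abs_le.mp (abs_le_of_sq_le_sq hsb hv.le)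
  have e1 : Real.cos (Real.arccos (t / a)) = t / a :=
    Real.cos_arccos (by rw [le_div_iff₀ hu]; linarith) (by rw [div_le_iff₀ hu]; linarith)
  have e2 : Real.cos (Real.arccos (s / b)) = s / b :=
    Real.cos_arccos (by rw [le_div_iff₀ hv]; linarith) (by rw [div_le_iff₀ hv]; linarith)
  have e3 : Real.sin (Real.arccos (t / a)) * Real.sin (Real.arccos (s / b)) =
      (a ^ 2 - t ^ 2) / (a * b) := by
    rw [Real.sin_arccos, Real.sin_arccos, ← Real.sqrt_mul, ← Real.sqrt_sq
      (show 0 ≤ (a ^ 2 - t ^ 2) / (a * b) from div_nonneg (by linarith) (by positivity))]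
    · congr 1
      field_simp
      rw [show b ^ 2 - s ^ 2 = a ^ 2 - t ^ 2 by linarith]
      ring
    · rw [sub_nonneg, div_pow, div_le_one (by positivity)]
      exact hta
  refine ⟨qubit (Real.arccos (t / a)) (Real.arccos (s / b)), qubit_isChannel _ _, fun ρ => ?_⟩
  have htr : ((qubit u v).apply ρ).trace = ρ.trace := trace_apply _ (qubit_isChannel u v) ρ
  refine (qubit_apply _ _ _).trans ?_
  rw [htr, qubit_apply, e1, e2, e3, qubit_compl]
  have k1 : (t / a : ℂ) * a = t := div_mul_cancel₀ _ (by exact_mod_cast hu.ne')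
  have k2 : (s / b : ℂ) * b = s := div_mul_cancel₀ _ (by exact_mod_cast hv.ne')
  have k3 : ((a ^ 2 - t ^ 2) / (a * b) : ℂ) + (t / a) * (s / b) * (s * t) = a * b := by
    have : ((a ^ 2 - t ^ 2) / (a * b) : ℝ) + (t / a) * (s / b) * (s * t) = a * b := by
      field_simp
      nlinarith
    exact_mod_cast this
  ext i j
  fin_cases i <;> fin_cases j <;>
    simp [-Complex.ofReal_cos, -Complex.ofReal_sin, blochMap, PauliZ, Matrix.trace] <;>
    grind

end KrausFamily

theorem PauliX_conjTranspose : PauliXᴴ = PauliX := by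
  ext i j
  fin_cases i <;> fin_cases j <;> simp [PauliX]

theorem PauliZ_conjTranspose : PauliZᴴ = PauliZ := by
  ext i j
  fin_cases i <;> fin_cases j <;> simp [PauliZ]

theorem PauliX_conj (ρ : Matrix (Fin 2) (Fin 2) ℂ) :
    PauliX * ρ * PauliX = !![ρ 1 1, ρ 1 0; ρ 0 1, ρ 0 0] := by
  rw [PauliX, Matrix.eta_fin_two ρ]
  simp

theorem PauliZ_conj (ρ : Matrix (Fin 2) (Fin 2) ℂ) :
    PauliZ * ρ * PauliZ = !![ρ 0 0, -ρ 0 1; -ρ 1 0, ρ 1 1] := by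
  rw [PauliZ, Matrix.eta_fin_two ρ]
  simp

theorem PauliX_conjTranspose_mul_self : PauliXᴴ * PauliX = 1 := by
  rw [PauliX_conjTranspose, PauliX, Matrix.one_fin_two]
  simp

theorem PauliZ_conjTranspose_mul_self : PauliZᴴ * PauliZ = 1 := by
  rw [PauliZ_conjTranspose, PauliZ, Matrix.one_fin_two]
  simp

/-- The unitary qubit rotation permuting the Bloch axes cyclically. -/
noncomputable def cyclicRotation : Matrix (Fin 2) (Fin 2) ℂ :=
  !![(1 - Complex.I) / 2, (-1 - Complex.I) / 2; (1 - Complex.I) / 2, (1 + Complex.I) / 2]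

theorem cyclicRotation_conjTranspose : cyclicRotationᴴ =
    !![(1 + Complex.I) / 2, (1 + Complex.I) / 2; (-1 + Complex.I) / 2, (1 - Complex.I) / 2] := by
  ext i j
  fin_cases i <;> fin_cases j <;> simp [cyclicRotation, sub_eq_add_neg]

theorem cyclicRotation_conjTranspose_mul_self : cyclicRotationᴴ * cyclicRotation = 1 := by
  rw [cyclicRotation_conjTranspose, cyclicRotation, Matrix.mul_fin_two, Matrix.one_fin_two]
  congr! 2 <;> ring_nf <;> simp only [Complex.I_sq] <;> ring_nf

theorem cyclicRotation_mul_conjTranspose_self : cyclicRotation * cyclicRotationᴴ = 1 :=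
  mul_eq_one_comm.mp cyclicRotation_conjTranspose_mul_self

theorem blochMap_cyclicRotation (a b c : ℝ) (ρ : Matrix (Fin 2) (Fin 2) ℂ) :
    cyclicRotationᴴ * blochMap a b c (cyclicRotation * ρ * cyclicRotationᴴ) * cyclicRotation =
      blochMap b c a ρ := by
  rw [cyclicRotation_conjTranspose, cyclicRotation, Matrix.eta_fin_two ρ, blochMap, blochMap]
  simp only [Matrix.mul_fin_two, Matrix.of_apply, Matrix.cons_val', Matrix.cons_val_zero,
    Matrix.cons_val_one, Matrix.cons_val_fin_one]
  congr! 2 <;> ring_nf <;> simp only [Complex.I_sq, Complex.I_pow_three, Complex.I_pow_four] <;>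
    ring

namespace KrausFamily

/-- Averaging a covariant map over conjugation by a unitary. -/
theorem HasGapBound.twirl {L L' : Matrix A A ℂ → Matrix A A ℂ} {f : Matrix A A ℂ → ℝ}
    (h : HasGapBound L f) {U : Matrix A A ℂ} (hU : Uᴴ * U = 1)
    (hL : ∀ ρ, ((1 / 2 : ℝ) : ℂ) • L ρ + ((1 / 2 : ℝ) : ℂ) • (Uᴴ * L (U * ρ * Uᴴ) * U) = L' ρ)
    (hf : ∀ ρ σ, IsDensity ρ → IsDensity σ → 1 / 2 * f ρ + 1 / 2 * f σ ≤
      f (((1 / 2 : ℝ) : ℂ) • ρ + ((1 / 2 : ℝ) : ℂ) • σ)) :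
    HasGapBound L'
      (fun φ => f (((1 / 2 : ℝ) : ℂ) • φ + ((1 / 2 : ℝ) : ℂ) • (U * φ * Uᴴ))) := by
  have hU' : U * Uᴴ = 1 := mul_eq_one_comm.mp hU
  refine (h.convexComb (h.conj hU hU') (by norm_num) (by norm_num) (by norm_num)).mono hL
    fun φ hφ => hf _ _ hφ ⟨hφ.1.mul_mul_conjTranspose_same U, ?_⟩
  rw [Matrix.trace_mul_cycle, hU, one_mul, hφ.2]

theorem cohInfo_qubit (u v : ℝ) :
    cohInfo (qubit u v) ((1 / 2 : ℂ) • 1) =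
      binEnt ((1 + Real.sin u * Real.sin v) / 2) -
        binEnt ((1 + Real.cos u * Real.cos v) / 2) := by
  have key : ∀ x a b c : ℝ, vnEntropy (blochMap a b c ((1 / 2 : ℂ) • 1) +
      ((x / 2 : ℝ) * ((1 / 2 : ℂ) • (1 : Matrix (Fin 2) (Fin 2) ℂ)).trace) • PauliZ) =
        binEnt ((1 + x) / 2) := by
    intro x a b c
    have h : blochMap a b c ((1 / 2 : ℂ) • 1) +
        ((x / 2 : ℝ) * ((1 / 2 : ℂ) • (1 : Matrix (Fin 2) (Fin 2) ℂ)).trace) • PauliZ =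
          Matrix.diagonal fun i => ((![(1 + x) / 2, 1 - (1 + x) / 2] i : ℝ) : ℂ) := by
      ext i j
      fin_cases i <;> fin_cases j <;> simp [blochMap, PauliZ] <;> ring_nf
    rw [h, vnEntropy_diagonal, binEnt]
    simp only [Fin.sum_univ_two, Matrix.cons_val_zero, Matrix.cons_val_one]
    ring
  rw [cohInfo, qubit_apply, key]
  congr 1
  exact (congrArg vnEntropy (qubit_compl u v _)).trans (key _ _ _ _)

theorem hasGapBound_blochMap {u v : ℝ} (hu : 0 < Real.cos u) (hv : 0 < Real.cos v)
    (h : |Real.sin v| ≤ |Real.cos u|) :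
    HasGapBound (blochMap (Real.cos u) (Real.cos v) (Real.cos u * Real.cos v))
      (fun _ => binEnt ((1 + Real.sin u * Real.sin v) / 2) -
        binEnt ((1 + Real.cos u * Real.cos v) / 2)) := by
  have hM := qubit_isChannel u v
  have hdeg := qubit_isDegradable hu hv h
  have h2 : (0 : ℝ) ≤ 1 / 2 := by norm_num
  have hconc : ∀ ρ σ, IsDensity ρ → IsDensity σ →
      1 / 2 * cohInfo (qubit u v) ρ + 1 / 2 * cohInfo (qubit u v) σ ≤
        cohInfo (qubit u v) (((1 / 2 : ℝ) : ℂ) • ρ + ((1 / 2 : ℝ) : ℂ) • σ) :=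
    fun ρ σ hρ hσ => cohInfo_concave hM hdeg h2 h2 (by norm_num) hρ hσ
  have hZ := (HasGapBound.of_isDegradable hM hdeg).twirl PauliZ_conjTranspose_mul_self
    (L' := (qubit u v).apply) (fun ρ => ?_) hconc
  · have hX := hZ.twirl PauliX_conjTranspose_mul_self
      (L' := blochMap (Real.cos u) (Real.cos v) (Real.cos u * Real.cos v)) (fun ρ => ?_)
      fun ρ σ hρ hσ => ?_
    · refine hX.mono (fun _ => rfl) fun φ hφ => ?_
      rw [← cohInfo_qubit]
      refine le_of_eq (congrArg _ ?_)
      have htr := hφ.2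
      rw [Matrix.trace_fin_two] at htr
      simp only [PauliX_conjTranspose, PauliX_conj, PauliZ_conjTranspose, PauliZ_conj]
      ext i j
      fin_cases i <;> fin_cases j <;> simp
      · linear_combination htr / 2
      · ring
      · ring
      · linear_combination htr / 2
    · simp only [PauliX_conjTranspose, PauliX_conj, qubit_apply]
      ext i j
      fin_cases i <;> fin_cases j <;> simp [PauliZ, blochMap, Matrix.trace_fin_two] <;> ring
    · have hconj : ∀ ρ : Matrix (Fin 2) (Fin 2) ℂ, IsDensity ρ →
          IsDensity (PauliZ * ρ * PauliZᴴ) := fun ρ hρ =>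
        ⟨hρ.1.mul_mul_conjTranspose_same _, by
          rw [Matrix.trace_mul_cycle, PauliZ_conjTranspose_mul_self, one_mul, hρ.2]⟩
      refine (hconc _ _ (hρ.convexComb h2 h2 (by norm_num) (hconj ρ hρ))
        (hσ.convexComb h2 h2 (by norm_num) (hconj σ hσ))).trans (le_of_eq (congrArg _ ?_))
      simp only [smul_add, Matrix.mul_add, Matrix.add_mul, Matrix.mul_smul, Matrix.smul_mul]
      abel
  · simp only [PauliZ_conjTranspose, PauliZ_conj, qubit_apply]
    ext i j
    fin_cases i <;> fin_cases j <;> simp [PauliZ, blochMap, Matrix.trace_fin_two] <;> ring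

/-- Averaging over cyclic permutations of the Bloch axes. -/
theorem HasGapBound.cyclic_average {a b c y : ℝ} (h : HasGapBound (blochMap a b c) (fun _ => y)) :
    HasGapBound (blochMap ((a + b + c) / 3) ((a + b + c) / 3) ((a + b + c) / 3))
      (fun _ => y) := by
  have hrot : ∀ {a b c : ℝ}, HasGapBound (blochMap a b c) (fun _ => y) →
      HasGapBound (blochMap b c a) (fun _ => y) := fun h =>
    (h.conj cyclicRotation_conjTranspose_mul_self cyclicRotation_mul_conjTranspose_self).mono
      (blochMap_cyclicRotation _ _ _) fun _ _ => le_rfl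
  have h2 := (hrot h).convexComb (hrot (hrot h)) (c := 1 / 2) (d := 1 / 2)
    (by norm_num) (by norm_num) (by norm_num)
  have h3 := h.convexComb h2 (c := 1 / 3) (d := 2 / 3) (by norm_num) (by norm_num) (by norm_num)
  refine h3.mono (fun ρ => ?_) fun _ _ => by linarith
  rw [blochMap_convexComb (by norm_num), blochMap_convexComb (by norm_num)]
  congr 1 <;> ring

theorem hasGapBound_depol_of_angles {p u v : ℝ} (hp0 : 0 ≤ p) (hp1 : p ≤ 1 / 4)
    (huv : Real.cos (u / 2) ^ 2 * Real.cos (v / 2) ^ 2 = 1 - p)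
    (h : |Real.sin v| ≤ |Real.cos u|) :
    HasGapBound (depol p).apply (fun _ => binEnt ((1 + Real.sin u * Real.sin v) / 2) -
      binEnt ((1 + Real.cos u * Real.cos v) / 2)) := by
  have hu2 := Real.cos_sq_le_one (u / 2)
  have hv2 := Real.cos_sq_le_one (v / 2)
  have hcu : Real.cos u = 2 * Real.cos (u / 2) ^ 2 - 1 := by
    rw [← Real.cos_two_mul]; congr 1; ring
  have hcv : Real.cos v = 2 * Real.cos (v / 2) ^ 2 - 1 := by
    rw [← Real.cos_two_mul]; congr 1; ring
  have hu : 0 < Real.cos u := by nlinarith [sq_nonneg (Real.cos (u / 2))]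
  have hv : 0 < Real.cos v := by nlinarith [sq_nonneg (Real.cos (v / 2))]
  refine (hasGapBound_blochMap hu hv h).cyclic_average.mono (fun ρ => ?_) fun _ _ => le_rfl
  rw [depol_apply hp0 (by linarith)]
  have : (Real.cos u + Real.cos v + Real.cos u * Real.cos v) / 3 = 1 - 4 * p / 3 := by
    rw [hcu, hcv]; linarith
  rw [this]

theorem depol_isAntidegradable : (depol (1 / 4)).IsAntidegradable := by
  have ht : ((√(1 / 2) : ℝ) : ℂ) ^ 2 = 1 / 2 := by
    rw [← Complex.ofReal_pow, Real.sq_sqrt (by norm_num)]; push_cast; rfl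
  have hs : ((√(1 / 12) : ℝ) : ℂ) ^ 2 = 1 / 12 := by
    rw [← Complex.ofReal_pow, Real.sq_sqrt (by norm_num)]; push_cast; rfl
  have hs' : √(1 - 1 / 4) = 3 * √(1 / 12) := by
    rw [show (1 - 1 / 4 : ℝ) = 3 ^ 2 * (1 / 12) by norm_num, Real.sqrt_mul (by norm_num),
      Real.sqrt_sq (by norm_num)]
  let D : KrausFamily (Fin 4) (Fin 2) := ⟨Fin 2, fun c => Matrix.of fun b i =>
    ((√(1 / 2) : ℝ) : ℂ) * (![1, PauliX, PauliY, PauliZ] i : Matrix (Fin 2) (Fin 2) ℂ) b c⟩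
  refine ⟨D, ?_, fun ρ => ?_⟩
  · change ∑ i : Fin 2, (D.K i)ᴴ * D.K i = 1
    simp only [D]
    generalize √(1 / 2) = t at ht
    ext i j
    fin_cases i <;> fin_cases j <;>
      simp [Fin.sum_univ_two, Matrix.mul_apply, PauliX, PauliY, PauliZ] <;>
      ring_nf <;> simp [ht]
  · rw [depol_apply (by norm_num) (by norm_num)]
    change ∑ c : Fin 2, D.K c * (Matrix.of fun i j : Fin 4 =>
      ((depol (1 / 4)).K i * ρ * ((depol (1 / 4)).K j)ᴴ).trace) * (D.K c)ᴴ = _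
    simp only [D, depol, hs', show (1 / 4 / 3 : ℝ) = 1 / 12 by norm_num]
    generalize √(1 / 2) = t at ht
    generalize √(1 / 12) = s at hs
    ext i j
    simp only [Fin.sum_univ_two, Matrix.add_apply, Matrix.mul_apply, Fin.sum_univ_four]
    fin_cases i <;> fin_cases j <;>
      simp [blochMap, PauliX, PauliY, PauliZ, Matrix.trace_fin_two, Matrix.mul_apply] <;>
      ring_nf <;> simp [ht, hs, map_ofNat (starRingEnd ℂ) 3] <;> ring

theorem HasGapBound.depol_convexComb {p q x y : ℝ} (hp0 : 0 ≤ p) (hp1 : p ≤ 1) (hq0 : 0 ≤ q)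
    (hq1 : q ≤ 1) (hp : HasGapBound (depol p).apply (fun _ => x))
    (hq : HasGapBound (depol q).apply (fun _ => y)) {c d : ℝ} (hc : 0 ≤ c) (hd : 0 ≤ d)
    (hcd : c + d = 1) :
    HasGapBound (depol (c * p + d * q)).apply (fun _ => c * x + d * y) := by
  refine (hp.convexComb hq hc hd hcd).mono (fun ρ => ?_) fun _ _ => le_rfl
  rw [depol_apply hp0 hp1, depol_apply hq0 hq1, depol_apply (by positivity) (by nlinarith),
    blochMap_convexComb hcd, show c * (1 - 4 * p / 3) + d * (1 - 4 * q / 3) =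
      1 - 4 * (c * p + d * q) / 3 by linear_combination hcd]

theorem hasGapBound_depol_linear {p : ℝ} (hp0 : 0 ≤ p) (hp1 : p ≤ 1 / 4) :
    HasGapBound (depol p).apply (fun _ => 1 - 4 * p) := by
  have h0 := hasGapBound_depol_of_angles (p := 0) (u := 0) (v := 0) le_rfl (by norm_num)
    (by simp) (by simp)
  have h1 := HasGapBound.of_isAntidegradable
    (depol_isChannel (p := 1 / 4) (by norm_num) (by norm_num)) depol_isAntidegradable
  have h2 := h0.depol_convexComb (c := 1 - 4 * p) (d := 4 * p) le_rfl (by norm_num) (by norm_num)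
    (by norm_num) h1 (by linarith) (by linarith) (by ring)
  rw [show (1 - 4 * p) * 0 + 4 * p * (1 / 4) = p by ring] at h2
  refine h2.mono (fun _ => rfl) fun _ _ => le_of_eq ?_
  have : Real.logb 2 (1 / 2) = -1 := by
    rw [one_div, Real.logb_inv, Real.logb_self_eq_one (by norm_num)]
  norm_num [binEnt, this]

end KrausFamily

namespace KrausFamily

/-- The least bound on the entropy gap obtainable for the depolarizing channel. -/
noncomputable def depolGapBound (p : ℝ) : ℝ :=
  sInf {y | HasGapBound (depol p).apply (fun _ => y)}

theorem bddBelow_hasGapBound (p : ℝ) :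
    BddBelow {y | HasGapBound (depol p).apply (fun _ => y)} :=
  ⟨0, fun _ h => HasGapBound.nonneg h⟩

theorem depolGapBound_le_linear {p : ℝ} (hp0 : 0 ≤ p) (hp1 : p ≤ 1 / 4) :
    depolGapBound p ≤ 1 - 4 * p :=
  csInf_le (bddBelow_hasGapBound p) (hasGapBound_depol_linear hp0 hp1)

theorem Qcap_depol_le_depolGapBound {p : ℝ} (hp0 : 0 ≤ p) (hp1 : p ≤ 1 / 4) :
    Qcap (depol p) ≤ depolGapBound p :=
  le_csInf ⟨_, hasGapBound_depol_linear hp0 hp1⟩ fun _ h => HasGapBound.Qcap_le h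

theorem depolGapBound_le_Δdep {p : ℝ} (hp0 : 0 ≤ p) (hp1 : p ≤ 1 / 4) :
    depolGapBound p ≤ Δdep p := by
  refine le_csInf ⟨_, 0, Real.arccos (1 - 2 * p), ?_, ?_, rfl⟩ ?_
  · rw [Real.cos_sq (_ / 2), Real.cos_sq (_ / 2), mul_div_cancel₀ _ two_ne_zero,
      mul_div_cancel₀ _ two_ne_zero, Real.cos_arccos (by linarith) (by linarith), Real.cos_zero]
    ring
  · rw [Real.cos_zero, abs_one]
    exact Real.abs_sin_le_one _
  · rintro _ ⟨u, v, huv, h, rfl⟩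
    exact csInf_le (bddBelow_hasGapBound p) (hasGapBound_depol_of_angles hp0 hp1 huv h)

theorem convexOn_depolGapBound : ConvexOn ℝ (Set.Icc (0 : ℝ) (1 / 4)) depolGapBound := by
  refine ⟨convex_Icc _ _, fun p hp q hq c d hc hd hcd => ?_⟩
  refine le_of_forall_pos_le_add fun ε hε => ?_
  obtain ⟨x, hx, hxε⟩ := Real.lt_sInf_add_pos
    (s := {y | HasGapBound (depol p).apply (fun _ => y)})
    ⟨_, hasGapBound_depol_linear hp.1 hp.2⟩ hε
  obtain ⟨y, hy, hyε⟩ := Real.lt_sInf_add_pos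
    (s := {y | HasGapBound (depol q).apply (fun _ => y)})
    ⟨_, hasGapBound_depol_linear hq.1 hq.2⟩ hε
  have h := csInf_le (bddBelow_hasGapBound (c * p + d * q))
    (HasGapBound.depol_convexComb hp.1 (by linarith [hp.2]) hq.1 (by linarith [hq.2]) hx hy
      hc hd hcd)
  have h1 := mul_le_mul_of_nonneg_left hxε.le hc
  have h2 := mul_le_mul_of_nonneg_left hyε.le hd
  have h3 : c * ε + d * ε = ε := by rw [← add_mul, hcd, one_mul]
  simp only [smul_eq_mul, depolGapBound]
  linarith

end KrausFamily

/-- For `0 ≤ p ≤ 1/4`, the quantum capacity of the depolarizing channel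
satisfies `Q(N_p) ≤ co[Δ, L](p)`, where `Δ` minimizes
`H(½(1+sin u sin v)) − H(½(1+cos u cos v))` over `(u,v)` with
`cos²(u/2)cos²(v/2) = 1 − p` and `|sin v| ≤ |cos u|`, `L(p) = 1 − 4p`, and `co[Δ, L]` is
the largest convex function on `[0, 1/4]` pointwise below both. -/
theorem depolarizing_capacity_le_convex_hull_Delta
    (p : ℝ) (hp0 : 0 ≤ p) (hp1 : p ≤ 1 / 4) :
    Qcap (depol p) ≤ convEnv {Δdep, fun q => 1 - 4 * q} p := by
  refine (KrausFamily.Qcap_depol_le_depolGapBound hp0 hp1).trans (le_csSup ⟨1 - 4 * p, ?_⟩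
    ⟨KrausFamily.depolGapBound, KrausFamily.convexOn_depolGapBound, fun z hz f hf => ?_, rfl⟩)
  · rintro _ ⟨g, -, hg, rfl⟩
    exact hg p ⟨hp0, hp1⟩ (fun q => 1 - 4 * q) (by simp)
  · rcases hf with rfl | rfl
    · exact KrausFamily.depolGapBound_le_Δdep hz.1 hz.2
    · exact KrausFamily.depolGapBound_le_linear hz.1 hz.2
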